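/- arXiv:1210.4771 — 11 statements merged into one kernel-verified Lean document; each statement's English description precedes it below -/
import Mathlib

section
/- Let θ ∈ (0,1) be an irrational number, φ(z) = e^{2πiθ}z, and let Y ⊆ 𝕋 be a closed set with φ^n(Y) ∩ Y = ∅ for every nonzero integer n. If μ is a Borel probability measure on 𝕋 such that ∫_𝕋 f(e^{-2πiθ}z) dμ(z) = ∫_𝕋 f(z) dμ(z) for every continuous function f : 𝕋 → ℂ that takes a single common value at all points of Y, then μ equals m, the normalized Haar measure on 𝕋. -/
open MeasureTheory

/-- The normalized Haar (arc-length) probability measure on the unit circle 𝕋 ⊆ ℂ,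
realized as the pushforward of Lebesgue measure on (0,1] under x ↦ e^{2πix}. -/
noncomputable def haarCircle : Measure ℂ :=
  Measure.map (fun x : ℝ => Complex.exp (2 * Real.pi * Complex.I * x))
    (volume.restrict (Set.Ioc (0 : ℝ) 1))

/-- Rotation of the complex plane about the origin by `s` full turns. -/
noncomputable def rotate (s : ℝ) (z : ℂ) : ℂ := Complex.exp (2 * Real.pi * Complex.I * s) * z

lemma continuous_rotate_uncurry : Continuous fun p : ℝ × ℂ => rotate p.1 p.2 := by
  unfold rotate; fun_prop

lemma continuous_rotate (s : ℝ) : Continuous (rotate s) := by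
  unfold rotate; fun_prop

lemma continuous_rotate_left (z : ℂ) : Continuous fun s => rotate s z := by
  unfold rotate; fun_prop

lemma rotate_add (s t : ℝ) (z : ℂ) : rotate (s + t) z = rotate s (rotate t z) := by
  unfold rotate
  rw [← mul_assoc, ← Complex.exp_add]
  congr 2
  push_cast
  ring

lemma rotate_zero : rotate 0 = id := by
  ext z; simp [rotate]

lemma rotate_one : rotate 1 = id := by
  ext z; simp [rotate, Complex.exp_two_pi_mul_I]

lemma norm_rotate (s : ℝ) (z : ℂ) : ‖rotate s z‖ = ‖z‖ := by
  have h : (2 * Real.pi * Complex.I * s : ℂ) = ((2 * Real.pi * s : ℝ) : ℂ) * Complex.I := by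
    push_cast; ring
  rw [rotate, norm_mul, h, Complex.norm_exp_ofReal_mul_I, one_mul]

lemma exists_rotate_eq_of_norm_eq_one {z : ℂ} (hz : ‖z‖ = 1) : ∃ s, z = rotate s 1 := by
  refine ⟨z.arg / (2 * Real.pi), ?_⟩
  have h := Complex.norm_mul_exp_arg_mul_I z
  rw [hz, Complex.ofReal_one, one_mul] at h
  rw [rotate, mul_one]
  nth_rewrite 1 [← h]
  congr 1
  have : (Real.pi : ℂ) ≠ 0 := by exact_mod_cast Real.pi_ne_zero
  push_cast
  field_simp

/-- The rotations preserving a measure form a subgroup. -/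
def rotationStabilizer (μ : Measure ℂ) : AddSubgroup ℝ where
  carrier := {s | μ.map (rotate s) = μ}
  zero_mem' := by simp [rotate_zero]
  add_mem' {s t} hs ht := by
    have h : rotate (s + t) = rotate s ∘ rotate t := funext (rotate_add s t)
    simp only [Set.mem_ofPred_eq] at hs ht ⊢
    rw [h, ← Measure.map_map (continuous_rotate s).measurable (continuous_rotate t).measurable,
      ht, hs]
  neg_mem' {s} hs := by
    have h : rotate (-s) ∘ rotate s = id := by
      ext z; simp [← rotate_add, rotate_zero]
    simp only [Set.mem_ofPred_eq] at hs ⊢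
    nth_rewrite 1 [← hs]
    rw [Measure.map_map (continuous_rotate _).measurable (continuous_rotate s).measurable, h,
      Measure.map_id]

lemma integrable_comp_rotate (μ : Measure ℂ) [IsFiniteMeasure μ]
    (g : BoundedContinuousFunction ℂ ℝ) (s : ℝ) : Integrable (fun z => g (rotate s z)) μ :=
  (g.compContinuous ⟨rotate s, continuous_rotate s⟩).integrable μ

lemma continuous_integral_rotate (μ : Measure ℂ) [IsFiniteMeasure μ]
    (g : BoundedContinuousFunction ℂ ℝ) : Continuous fun s => ∫ z, g (rotate s z) ∂μ := by
  refine continuous_of_dominated (bound := fun _ => ‖g‖)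
    (fun s => (integrable_comp_rotate μ g s).aestronglyMeasurable)
    (fun s => .of_forall fun z => g.norm_coe_le_norm _) (integrable_const _)
    (.of_forall fun z => g.continuous.comp (continuous_rotate_left z))

lemma integral_rotate_eq_of_irrational (μ : Measure ℂ) [IsFiniteMeasure μ] {θ : ℝ}
    (hθ : Irrational θ) (hμ : μ.map (rotate θ) = μ) (g : BoundedContinuousFunction ℂ ℝ) (s : ℝ) :
    ∫ z, g (rotate s z) ∂μ = ∫ z, g z ∂μ := by
  have hd : Dense (AddSubgroup.closure {θ, 1} : Set ℝ) :=
    dense_addSubgroupClosure_pair_iff.2 (by simpa using hθ)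
  have hle : AddSubgroup.closure {θ, 1} ≤ rotationStabilizer μ := by
    rw [AddSubgroup.closure_le]
    rintro t (rfl | rfl)
    · exact hμ
    · change μ.map (rotate 1) = μ
      rw [rotate_one, Measure.map_id]
  refine congrFun ((continuous_integral_rotate μ g).ext_on hd continuous_const fun t ht => ?_) s
  have h : μ.map (rotate t) = μ := hle ht
  nth_rewrite 2 [← h]
  rw [integral_map (continuous_rotate t).aemeasurable g.continuous.aestronglyMeasurable]

lemma integral_haarCircle (g : BoundedContinuousFunction ℂ ℝ) :
    ∫ z, g z ∂haarCircle = ∫ s in (0 : ℝ)..1, g (rotate s 1) := by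
  rw [haarCircle, integral_map (Measurable.aemeasurable (by fun_prop))
    g.continuous.aestronglyMeasurable, intervalIntegral.integral_of_le zero_le_one]
  simp [rotate]

instance : IsProbabilityMeasure haarCircle := by
  have : IsProbabilityMeasure ((volume : Measure ℝ).restrict (Set.Ioc 0 1)) := ⟨by simp⟩
  exact Measure.isProbabilityMeasure_map (Measurable.aemeasurable (by fun_prop))

lemma intervalIntegral_rotate {z : ℂ} (hz : ‖z‖ = 1) (g : BoundedContinuousFunction ℂ ℝ) :
    ∫ s in (0 : ℝ)..1, g (rotate s z) = ∫ w, g w ∂haarCircle := by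
  obtain ⟨t, rfl⟩ := exists_rotate_eq_of_norm_eq_one hz
  have hp : Function.Periodic (fun s => g (rotate s 1)) 1 := fun s => by
    simp [rotate_add, rotate_one]
  have h := hp.intervalIntegral_add_eq t 0
  rw [integral_haarCircle]
  simp_rw [← rotate_add]
  rw [intervalIntegral.integral_comp_add_right (fun s => g (rotate s 1)) t]
  simpa [add_comm] using h

/-- Unique ergodicity of irrational rotations of the circle. -/
theorem eq_haarCircle_of_map_rotate_eq (μ : Measure ℂ) [IsProbabilityMeasure μ]
    (hsupp : ∀ᵐ z ∂μ, ‖z‖ = 1) {θ : ℝ} (hθ : Irrational θ) (hμ : μ.map (rotate θ) = μ) :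
    μ = haarCircle := by
  refine ext_of_forall_integral_eq_of_IsFiniteMeasure fun g => ?_
  have hint : Integrable (Function.uncurry fun (s : ℝ) z => g (rotate s z))
      ((volume.restrict (Set.Ioc (0 : ℝ) 1)).prod μ) :=
    (g.compContinuous ⟨_, continuous_rotate_uncurry⟩).integrable _
  calc ∫ z, g z ∂μ = ∫ s in (0 : ℝ)..1, ∫ z, g (rotate s z) ∂μ := by
        simp [integral_rotate_eq_of_irrational μ hθ hμ g]
    _ = ∫ z, (∫ s in (0 : ℝ)..1, g (rotate s z)) ∂μ := by
        simp_rw [intervalIntegral.integral_of_le zero_le_one]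
        exact integral_integral_swap hint
    _ = ∫ _, (∫ w, g w ∂haarCircle) ∂μ :=
        integral_congr_ae (hsupp.mono fun z hz => intervalIntegral_rotate hz g)
    _ = ∫ w, g w ∂haarCircle := by simp

/-- Two finite measures that integrate equally every bounded continuous function vanishing on a
closed set agree off that set. -/
lemma restrict_compl_eq_of_forall_integral_eq (μ ν : Measure ℂ) [IsFiniteMeasure μ]
    [IsFiniteMeasure ν] {Y : Set ℂ} (hY : IsClosed Y)
    (h : ∀ f : BoundedContinuousFunction ℂ ℝ, (∀ y ∈ Y, f y = 0) →
      ∫ z, f z ∂μ = ∫ z, f z ∂ν) : μ.restrict Yᶜ = ν.restrict Yᶜ := by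
  refine ext_of_forall_integral_eq_of_IsFiniteMeasure fun g => ?_
  let δ : ℕ → ℝ := fun n => 1 / (n + 1 : ℝ)
  have hδ : ∀ n, 0 < δ n := fun n => by positivity
  let c : ℕ → ℂ → ℝ := fun n z => (1 - (thickenedIndicator (hδ n) Y z : ℝ)) * g z
  have hc : ∀ n, Continuous (c n) := fun n => by
    have := (thickenedIndicator (hδ n) Y).continuous
    have := g.continuous
    fun_prop
  have hbound : ∀ n z, ‖c n z‖ ≤ ‖g‖ := fun n z => by
    have h1 : (thickenedIndicator (hδ n) Y z : ℝ) ≤ 1 := by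
      exact_mod_cast thickenedIndicator_le_one (hδ n) Y z
    have h0 : (0 : ℝ) ≤ thickenedIndicator (hδ n) Y z := NNReal.coe_nonneg _
    have h2 : ‖1 - (thickenedIndicator (hδ n) Y z : ℝ)‖ ≤ 1 := by
      rw [Real.norm_eq_abs, abs_le]; constructor <;> linarith
    rw [norm_mul]
    calc _ ≤ 1 * ‖g‖ := mul_le_mul h2 (g.norm_coe_le_norm z) (norm_nonneg _) zero_le_one
      _ = ‖g‖ := one_mul _
  have hlim : ∀ z, Filter.Tendsto (fun n => c n z) Filter.atTop (nhds (Yᶜ.indicator g z)) := by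
    intro z
    have ht := tendsto_pi_nhds.1 (thickenedIndicator_tendsto_indicator_closure hδ
      tendsto_one_div_add_atTop_nhds_zero_nat Y) z
    have ht' := ((tendsto_const_nhds (x := (1 : ℝ))).sub
      ((NNReal.continuous_coe.tendsto _).comp ht)).mul (tendsto_const_nhds (x := g z))
    have hval : Yᶜ.indicator g z =
        (1 - NNReal.toReal ((closure Y).indicator (fun _ => 1) z)) * g z := by
      rw [hY.closure_eq]
      by_cases hz : z ∈ Y <;> simp [hz]
    rw [hval]
    exact ht'
  have key : ∀ (ρ : Measure ℂ) [IsFiniteMeasure ρ], Filter.Tendsto (fun n => ∫ z, c n z ∂ρ)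
      Filter.atTop (nhds (∫ z in Yᶜ, g z ∂ρ)) := fun ρ _ => by
    rw [← integral_indicator hY.measurableSet.compl]
    exact tendsto_integral_of_dominated_convergence (fun _ => ‖g‖)
      (fun n => (hc n).aestronglyMeasurable) (integrable_const _)
      (fun n => .of_forall (hbound n)) (.of_forall hlim)
  refine tendsto_nhds_unique (key μ) ((key ν).congr fun n => ?_)
  refine (h (BoundedContinuousFunction.ofNormedAddCommGroup (c n) (hc n) ‖g‖ (hbound n))
    fun y hy => ?_).symm
  have h1 := thickenedIndicator_one (hδ n) Y hy
  change (1 - (thickenedIndicator (hδ n) Y y : ℝ)) * g y = 0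
  simp only [h1, NNReal.coe_one, sub_self, zero_mul]

/-- A sequence of pairwise disjoint sets of equal measure in a finite measure space is null. -/
lemma measure_eq_zero_of_pairwise_disjoint {α : Type*} [MeasurableSpace α] (μ : Measure α)
    [IsFiniteMeasure μ] {E : ℕ → Set α} (hE : ∀ n, MeasurableSet (E n))
    (hd : Pairwise (Function.onFun Disjoint E)) (h : ∀ n, μ (E (n + 1)) = μ (E n)) :
    μ (E 0) = 0 := by
  have hc : ∀ n, μ (E n) = μ (E 0) := fun n => by
    induction n with
    | zero => rfl
    | succ n ih => rw [h, ih]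
  by_contra h0
  have := measure_iUnion hd hE (μ := μ)
  simp_rw [hc, ENNReal.tsum_const_eq_top_of_ne_zero h0] at this
  exact measure_ne_top μ _ this

lemma measure_rotate_preimage_eq_zero (μ : Measure ℂ) [IsFiniteMeasure μ] {θ : ℝ} {Y : Set ℂ}
    (hY : MeasurableSet Y)
    (hdisj : ∀ n : ℤ, n ≠ 0 → Disjoint (rotate (n * θ) ⁻¹' Y) Y)
    (h : (μ.map (rotate θ)).restrict Yᶜ = μ.restrict Yᶜ) :
    μ Y = 0 ∧ μ (rotate θ ⁻¹' Y) = 0 := by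
  let E : ℤ → Set ℂ := fun n => rotate (n * θ) ⁻¹' Y
  have hE : ∀ n, MeasurableSet (E n) := fun n => (continuous_rotate _).measurable hY
  have hshift : ∀ m n : ℤ, rotate (m * θ) ⁻¹' E n = E (n + m) := fun m n => by
    ext z; simp [E, ← rotate_add, add_mul]
  have hd : Pairwise (Function.onFun Disjoint E) := fun m n hmn => by
    have := (hdisj (m - n) (sub_ne_zero.2 hmn)).preimage (rotate (n * θ))
    have h1 := hshift n (m - n)
    rw [sub_add_cancel] at h1
    rwa [h1] at this
  have hstep : ∀ n : ℤ, n ≠ 0 → μ (E (n + 1)) = μ (E n) := fun n hn => by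
    have hsub : E n ⊆ Yᶜ := (hdisj n hn).subset_compl_right
    have h1 := congrArg (fun ρ : Measure ℂ => ρ (E n)) h
    simp only [Measure.restrict_apply (hE n), Set.inter_eq_left.2 hsub,
      Measure.map_apply (continuous_rotate θ).measurable (hE n)] at h1
    have h2 := hshift 1 n
    rw [Int.cast_one, one_mul] at h2
    rwa [h2] at h1
  constructor
  · have := measure_eq_zero_of_pairwise_disjoint μ (E := fun n : ℕ => E (-n)) (fun n => hE _)
      (fun m n hmn => hd (by simpa using hmn)) fun n => by
        rw [← hstep (-((n + 1 : ℕ) : ℤ)) (by omega)]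
        congr 2
        push_cast
        ring
    simpa [E, rotate_zero] using this
  · have := measure_eq_zero_of_pairwise_disjoint μ (E := fun n : ℕ => E (n + 1)) (fun n => hE _)
      (fun m n hmn => hd (by simpa using hmn)) fun n => by
        have := hstep (n + 1) (by omega)
        exact_mod_cast this
    simpa [E] using this

/-- Let θ ∈ (0,1) be irrational, φ(z) = e^{2πiθ}z, and Y ⊆ 𝕋 closed with
φⁿ(Y) ∩ Y = ∅ for every nonzero integer n.  If μ is a Borel probability measure on 𝕋
such that ∫ f(e^{-2πiθ}z) dμ(z) = ∫ f(z) dμ(z) for every continuous function f on 𝕋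
taking a single common value at all points of Y, then μ is the normalized Haar measure. -/
theorem stmt_1 (θ : ℝ) (hθ : θ ∈ Set.Ioo (0 : ℝ) 1) (hirr : Irrational θ)
    (Y : Set ℂ) (hYclosed : IsClosed Y) (hY : Y ⊆ Metric.sphere (0 : ℂ) 1)
    (hdisj : ∀ n : ℤ, n ≠ 0 →
      (fun z : ℂ => Complex.exp (2 * Real.pi * Complex.I * θ * n) * z) '' Y ∩ Y = ∅)
    (μ : Measure ℂ) [IsProbabilityMeasure μ]
    (hsupp : μ (Metric.sphere (0 : ℂ) 1)ᶜ = 0)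
    (hinv : ∀ f : ℂ → ℂ, ContinuousOn f (Metric.sphere (0 : ℂ) 1) →
      (∀ y ∈ Y, ∀ y' ∈ Y, f y = f y') →
      ∫ z, f (Complex.exp (-(2 * Real.pi * Complex.I * θ)) * z) ∂μ = ∫ z, f z ∂μ) :
    μ = haarCircle := by
  have hrot : ∀ z, Complex.exp (-(2 * Real.pi * Complex.I * θ)) * z = rotate (-θ) z := fun z => by
    simp [rotate]
  have hdisj' : ∀ n : ℤ, n ≠ 0 → Disjoint (rotate (n * -θ) ⁻¹' Y) Y := fun n hn => by
    rw [Set.disjoint_left]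
    intro z hz hzY
    refine (Set.eq_empty_iff_forall_notMem.1 (hdisj n hn)) z ⟨⟨_, hz, ?_⟩, hzY⟩
    have h1 : rotate (n * θ) (rotate (n * -θ) z) = z := by simp [← rotate_add, rotate_zero]
    nth_rewrite 2 [← h1]
    rw [rotate.eq_1 (n * θ)]
    push_cast
    ring_nf
  have : IsProbabilityMeasure (μ.map (rotate (-θ))) :=
    Measure.isProbabilityMeasure_map (continuous_rotate _).aemeasurable
  have hres : (μ.map (rotate (-θ))).restrict Yᶜ = μ.restrict Yᶜ := by
    refine restrict_compl_eq_of_forall_integral_eq _ _ hYclosed fun f hf => ?_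
    have h := hinv (fun z => (f z : ℂ)) (by have := f.continuous; fun_prop)
      fun y hy y' hy' => by rw [hf y hy, hf y' hy']
    simp only [hrot, integral_complex_ofReal] at h
    rw [integral_map (continuous_rotate _).aemeasurable f.continuous.aestronglyMeasurable]
    exact_mod_cast h
  obtain ⟨h0, h1⟩ := measure_rotate_preimage_eq_zero μ hYclosed.measurableSet hdisj' hres
  refine eq_haarCircle_of_map_rotate_eq μ ?_ hirr.neg ?_
  · filter_upwards [compl_mem_ae_iff.2 hsupp] with z hz
    simpa using hz
  · have hm := hYclosed.measurableSet
    rw [← Measure.restrict_add_restrict_compl (μ := μ.map (rotate (-θ))) hm, hres,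
      Measure.restrict_eq_zero.2 (by rwa [Measure.map_apply (continuous_rotate _).measurable hm]),
      ← Measure.restrict_eq_zero.2 h0, Measure.restrict_add_restrict_compl hm]
end

section
/- Let θ ∈ (0,1) be an irrational number and Y ⊆ 𝕋 a closed set. Suppose there exist z₁ ∈ Y and a positive integer k such that e^{2πikθ}z₁ ∈ Y. Then the Borel probability measure μ = (1/k)·(δ_{e^{2πiθ}z₁} + δ_{e^{2πi·2θ}z₁} + ⋯ + δ_{e^{2πikθ}z₁}) satisfies ∫_𝕋 f(e^{-2πiθ}z) dμ(z) = ∫_𝕋 f(z) dμ(z) for every continuous function f : 𝕋 → ℂ that takes a single common value at all points of Y, and μ is different from the normalized Haar measure m on 𝕋. -/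
open MeasureTheory

/-- The normalized Haar measure on the circle has no atoms. -/
lemma haarCircle_singleton (w : ℂ) : haarCircle {w} = 0 := by
  have hmeas : Measurable (fun x : ℝ => Complex.exp (2 * Real.pi * Complex.I * x)) := by
    fun_prop
  rw [haarCircle, Measure.map_apply hmeas (measurableSet_singleton w),
    Measure.restrict_apply (hmeas (measurableSet_singleton w))]
  refine Set.Subsingleton.measure_zero ?_ _
  rintro x ⟨hx, hx0, hx1⟩ y ⟨hy, hy0, hy1⟩
  simp only [Set.mem_preimage, Set.mem_singleton_iff] at hx hy
  obtain ⟨n, hn⟩ := Complex.exp_eq_exp_iff_exists_int.1 (hx.trans hy.symm)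
  have hxy : x = y + n := by
    have h : (2 * Real.pi * Complex.I) * (x : ℂ) = 2 * Real.pi * Complex.I * ((y + n : ℝ) : ℂ) := by
      rw [hn]; push_cast; ring
    exact_mod_cast mul_left_cancel₀ Complex.two_pi_I_ne_zero h
  have h1 : (n : ℝ) < 1 := by linarith
  have h2 : (-1 : ℝ) < n := by linarith
  have hn0 : n = 0 := by
    have h1' : n < 1 := by exact_mod_cast h1
    have h2' : -1 < n := by exact_mod_cast h2
    omega
  simpa [hn0] using hxy

/-- The integral against a scaled finite sum of Dirac masses is the scaled sum of values. -/
lemma integral_smul_sum_dirac {ι : Type*} (s : Finset ι) (c : ENNReal) (p : ι → ℂ) (f : ℂ → ℂ) :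
    ∫ z, f z ∂(c • ∑ j ∈ s, Measure.dirac (p j)) = c.toReal • ∑ j ∈ s, f (p j) := by
  rw [integral_smul_measure, integral_finsetSum_measure]
  · simp only [integral_dirac]
  · intro j _
    exact integrable_dirac enorm_lt_top

/-- Let θ ∈ (0,1) be irrational, Y ⊆ 𝕋 closed, z₁ ∈ Y and k ≥ 1 with
e^{2πikθ}z₁ ∈ Y.  Then μ = (1/k)(δ_{e^{2πiθ}z₁} + ⋯ + δ_{e^{2πikθ}z₁}) satisfies
∫ f(e^{-2πiθ}z) dμ(z) = ∫ f(z) dμ(z) for every continuous f on 𝕋 taking a single common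
value at all points of Y, and μ is different from the normalized Haar measure on 𝕋. -/
theorem stmt_2 (θ : ℝ) (hθ : θ ∈ Set.Ioo (0 : ℝ) 1) (hirr : Irrational θ)
    (Y : Set ℂ) (hYclosed : IsClosed Y) (hY : Y ⊆ Metric.sphere (0 : ℂ) 1)
    (z₁ : ℂ) (hz₁ : z₁ ∈ Y) (k : ℕ) (hk : 0 < k)
    (hzk : Complex.exp (2 * Real.pi * Complex.I * θ * k) * z₁ ∈ Y)
    (μ : Measure ℂ)
    (hμ : μ = (k : ENNReal)⁻¹ • ∑ j ∈ Finset.range k,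
        Measure.dirac (Complex.exp (2 * Real.pi * Complex.I * θ * (j + 1)) * z₁)) :
    (∀ f : ℂ → ℂ, ContinuousOn f (Metric.sphere (0 : ℂ) 1) →
      (∀ y ∈ Y, ∀ y' ∈ Y, f y = f y') →
      ∫ z, f (Complex.exp (-(2 * Real.pi * Complex.I * θ)) * z) ∂μ = ∫ z, f z ∂μ)
    ∧ μ ≠ haarCircle := by
  subst hμ
  refine ⟨fun f _ hf => ?_, fun h => ?_⟩
  · rw [integral_smul_sum_dirac, integral_smul_sum_dirac]
    congr 1
    set g : ℕ → ℂ := fun j => f (Complex.exp (2 * Real.pi * Complex.I * θ * j) * z₁) with hg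
    have hshift : ∀ j : ℕ, f (Complex.exp (-(2 * Real.pi * Complex.I * θ)) *
        (Complex.exp (2 * Real.pi * Complex.I * θ * (j + 1)) * z₁)) = g j := by
      intro j
      rw [hg, ← mul_assoc, ← Complex.exp_add]
      ring_nf
    have hsucc : ∀ j : ℕ,
        f (Complex.exp (2 * Real.pi * Complex.I * θ * (j + 1)) * z₁) = g (j + 1) := by
      intro j
      simp [hg]
    have hends : g 0 = g k := by
      simpa [hg] using hf z₁ hz₁ _ hzk
    simp only [hshift, hsucc]
    have hsum := (Finset.sum_range_succ g k).symm.trans (Finset.sum_range_succ' g k)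
    rw [hends] at hsum
    exact add_right_cancel hsum
  · set w := Complex.exp (2 * Real.pi * Complex.I * θ * ((0 : ℕ) + 1)) * z₁ with hw
    have h0 := haarCircle_singleton w
    rw [← h, Measure.smul_apply, smul_eq_mul, mul_eq_zero, Measure.finsetSum_apply,
      Finset.sum_eq_zero_iff] at h0
    rcases h0 with h0 | h0
    · exact ENNReal.inv_ne_zero.2 (ENNReal.natCast_ne_top k) h0
    · simpa [hw] using h0 0 (Finset.mem_range.2 hk)
end

section
/- Let θ ∈ (0, 1/2) and let β : ℝ → ℝ be a continuous 1-periodic nonnegative function with β(0) ≠ 0. Then there exist continuous 1-periodic functions f, g : ℝ → ℝ with 0 ≤ f(t) ≤ 1 for all t, such that for every t ∈ ℝ: (i) g(t)g(t−θ) = 0; (ii) g(t)(1 − f(t) − f(t−θ)) = 0; (iii) f(t) − f(t)² = (g(t)β(t−θ))² + (g(t+θ)β(t))²; and moreover ∫₀¹ f(t) dt = θ. -/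
/-- The ramp of width `ε`: zero on `(-∞, 0]`, linear on `[0, ε]`, and one on `[ε, ∞)`. -/
noncomputable def ramp (ε x : ℝ) : ℝ := max 0 (min 1 (x / ε))

theorem continuous_ramp (ε : ℝ) : Continuous (ramp ε) := by
  unfold ramp
  fun_prop

theorem ramp_nonneg (ε x : ℝ) : 0 ≤ ramp ε x := le_max_left _ _

theorem ramp_le_one (ε x : ℝ) : ramp ε x ≤ 1 :=
  max_le zero_le_one (min_le_left _ _)

theorem ramp_of_nonpos {ε x : ℝ} (hε : 0 < ε) (hx : x ≤ 0) : ramp ε x = 0 :=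
  max_eq_left ((min_le_right _ _).trans (div_nonpos_of_nonpos_of_nonneg hx hε.le))

theorem ramp_of_le {ε x : ℝ} (hε : 0 < ε) (hx : ε ≤ x) : ramp ε x = 1 := by
  rw [ramp, min_eq_left ((one_le_div hε).2 hx), max_eq_right zero_le_one]

theorem monotone_ramp {ε : ℝ} (hε : 0 < ε) : Monotone (ramp ε) := fun x y h => by
  unfold ramp
  gcongr

/-- A continuous function that is positive at zero is bounded below by a positive constant on a
short interval `[0, ε]`, where `ε` may be taken below any given positive bound. -/
theorem exists_pos_lower_bound_on_Icc {β : ℝ → ℝ} (hβ : Continuous β) (h0 : 0 < β 0)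
    {b : ℝ} (hb : 0 < b) :
    ∃ ε m : ℝ, 0 < ε ∧ ε ≤ b ∧ 0 < m ∧ ∀ s ∈ Set.Icc 0 ε, m ≤ β s := by
  have h : ∀ᶠ s in nhds (0 : ℝ), β 0 / 2 < β s :=
    hβ.continuousAt.eventually (lt_mem_nhds (half_lt_self h0))
  obtain ⟨δ, hδ, H⟩ := Metric.eventually_nhds_iff.1 h
  refine ⟨min b (δ / 2), β 0 / 2, lt_min hb (half_pos hδ), min_le_left _ _, half_pos h0,
    fun s hs => (H ?_).le⟩
  have := hs.2.trans (min_le_right _ _)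
  rw [Real.dist_eq, sub_zero, abs_of_nonneg hs.1]
  linarith

theorem intervalIntegral_ramp_sub_ramp {ε θ : ℝ} (hε : 0 < ε) (hθ : 0 ≤ θ) (h : θ + ε ≤ 1) :
    ∫ x in (0 : ℝ)..1, (ramp ε x - ramp ε (x - θ)) = θ := by
  have hi : ∀ a b : ℝ, IntervalIntegrable (ramp ε) MeasureTheory.volume a b :=
    fun a b => (continuous_ramp ε).intervalIntegrable a b
  have h₀ : ∫ x in (-θ)..0, ramp ε x = 0 := by
    rw [intervalIntegral.integral_congr (g := fun _ => (0 : ℝ))]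
    · simp
    · intro x hx
      rw [Set.uIcc_of_le (by linarith)] at hx
      exact ramp_of_nonpos hε hx.2
  have h₁ : ∫ x in (1 - θ)..1, ramp ε x = θ := by
    rw [intervalIntegral.integral_congr (g := fun _ => (1 : ℝ))]
    · simp
    · intro x hx
      rw [Set.uIcc_of_le (by linarith)] at hx
      exact ramp_of_le hε (by linarith [hx.1])
  have hs : ∫ x in (0 : ℝ)..1, ramp ε (x - θ) = ∫ x in (-θ)..(1 - θ), ramp ε x := by
    rw [intervalIntegral.integral_comp_sub_right (ramp ε), zero_sub]
  have hc : Continuous fun x => ramp ε (x - θ) :=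
    (continuous_ramp ε).comp (continuous_sub_right θ)
  rw [intervalIntegral.integral_sub (hi 0 1) (hc.intervalIntegrable 0 1), hs]
  have e₁ := intervalIntegral.integral_add_adjacent_intervals (hi (-θ) 0) (hi 0 1)
  have e₂ := intervalIntegral.integral_add_adjacent_intervals (hi (-θ) (1 - θ)) (hi (1 - θ) 1)
  linarith

/-- The off-diagonal profile: supported on `[θ, θ + ε]`, its square times `β (x - θ) ^ 2` is
`ramp ε (x - θ) * (1 - ramp ε (x - θ))` wherever `m ≤ β` on `[0, ε]`. -/
noncomputable def offDiagonalProfile (β : ℝ → ℝ) (ε m θ x : ℝ) : ℝ :=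
  √(ramp ε (x - θ) * (1 - ramp ε (x - θ))) / max (β (x - θ)) m

theorem continuous_offDiagonalProfile {β : ℝ → ℝ} (hβ : Continuous β) (ε : ℝ) {m : ℝ}
    (hm : 0 < m) (θ : ℝ) : Continuous (offDiagonalProfile β ε m θ) := by
  have := continuous_ramp ε
  unfold offDiagonalProfile
  exact Continuous.div (by fun_prop) (by fun_prop) fun x => (lt_max_of_lt_right hm).ne'

theorem offDiagonalProfile_of_le {β : ℝ → ℝ} {ε m θ x : ℝ} (hε : 0 < ε) (hx : x ≤ θ) :
    offDiagonalProfile β ε m θ x = 0 := by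
  simp [offDiagonalProfile, ramp_of_nonpos hε (sub_nonpos.2 hx)]

theorem offDiagonalProfile_of_ge {β : ℝ → ℝ} {ε m θ x : ℝ} (hε : 0 < ε) (hx : θ + ε ≤ x) :
    offDiagonalProfile β ε m θ x = 0 := by
  simp [offDiagonalProfile, ramp_of_le hε (le_sub_iff_add_le'.2 hx)]

theorem sq_offDiagonalProfile_mul {β : ℝ → ℝ} {ε m : ℝ} (hε : 0 < ε) (hm : 0 < m)
    (hβ : ∀ s ∈ Set.Icc 0 ε, m ≤ β s) (θ x : ℝ) :
    (offDiagonalProfile β ε m θ x * β (x - θ)) ^ 2 =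
      ramp ε (x - θ) * (1 - ramp ε (x - θ)) := by
  rcases le_total x θ with h | h
  · simp [offDiagonalProfile_of_le hε h, ramp_of_nonpos hε (sub_nonpos.2 h)]
  rcases le_total (θ + ε) x with h' | h'
  · simp [offDiagonalProfile_of_ge hε h', ramp_of_le hε (le_sub_iff_add_le'.2 h')]
  have hb := hβ (x - θ) ⟨by linarith, by linarith⟩
  rw [offDiagonalProfile, max_eq_left hb, div_mul_cancel₀ _ (hm.trans_le hb).ne',
    Real.sq_sqrt (mul_nonneg (ramp_nonneg _ _) (sub_nonneg.2 (ramp_le_one _ _)))]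


/-- Let θ ∈ (0, 1/2) and let β : ℝ → ℝ be a continuous 1-periodic
nonnegative function with β(0) ≠ 0.  Then there exist continuous 1-periodic functions
f, g : ℝ → ℝ with 0 ≤ f ≤ 1 such that for all t:
(i) g(t)g(t−θ) = 0; (ii) g(t)(1 − f(t) − f(t−θ)) = 0;
(iii) f(t) − f(t)² = (g(t)β(t−θ))² + (g(t+θ)β(t))²; and ∫₀¹ f(t) dt = θ. -/
theorem stmt_6 (θ : ℝ) (hθ : θ ∈ Set.Ioo (0 : ℝ) (1 / 2))
    (β : ℝ → ℝ) (hβc : Continuous β) (hβp : ∀ t : ℝ, β (t + 1) = β t)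
    (hβ0 : ∀ t : ℝ, 0 ≤ β t) (hβne : β 0 ≠ 0) :
    ∃ f g : ℝ → ℝ, Continuous f ∧ Continuous g ∧
      (∀ t : ℝ, f (t + 1) = f t) ∧ (∀ t : ℝ, g (t + 1) = g t) ∧
      (∀ t : ℝ, 0 ≤ f t ∧ f t ≤ 1) ∧
      (∀ t : ℝ, g t * g (t - θ) = 0) ∧
      (∀ t : ℝ, g t * (1 - f t - f (t - θ)) = 0) ∧
      (∀ t : ℝ, f t - (f t) ^ 2 = (g t * β (t - θ)) ^ 2 + (g (t + θ) * β t) ^ 2) ∧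
      (∫ t in (0 : ℝ)..1, f t) = θ := by
  obtain ⟨hθ0, hθ1⟩ := hθ
  obtain ⟨ε, m, hε, hεθ, hm, hmβ⟩ :=
    exists_pos_lower_bound_on_Icc hβc ((hβ0 0).lt_of_ne' hβne) hθ0
  let F : ℝ → ℝ := fun x => ramp ε x - ramp ε (x - θ)
  let G : ℝ → ℝ := offDiagonalProfile β ε m θ
  have hFc : Continuous F := (continuous_ramp ε).sub ((continuous_ramp ε).comp (by fun_prop))
  have hGc : Continuous G := continuous_offDiagonalProfile hβc ε hm θ
  have hGl : ∀ {x}, x ≤ θ → G x = 0 := fun h => offDiagonalProfile_of_le hε h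
  have hGr : ∀ {x}, θ + ε ≤ x → G x = 0 := fun h => offDiagonalProfile_of_ge hε h
  have hGβ : ∀ x, (G x * β (x - θ)) ^ 2 = ramp ε (x - θ) * (1 - ramp ε (x - θ)) :=
    sq_offDiagonalProfile_mul hε hm hmβ θ
  have hFl : ∀ {x}, x ≤ θ → F x = ramp ε x := fun {x} h => by
    simp [F, ramp_of_nonpos hε (sub_nonpos.2 h)]
  have hFr : ∀ {x}, ε ≤ x → F x = 1 - ramp ε (x - θ) := fun {x} h => by
    simp [F, ramp_of_le hε h]
  have hβf : ∀ t s : ℝ, β (Int.fract t - s) = β (t - s) := fun t s => by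
    have h := Function.Periodic.sub_int_mul_eq (f := β) (c := 1) (x := t - s) hβp ⌊t⌋
    rw [← h, Int.fract]
    ring_nf
  have fract_sub : ∀ t, θ ≤ Int.fract t → Int.fract (t - θ) = Int.fract t - θ := fun t h =>
    Int.fract_eq_iff.2 ⟨by linarith, by linarith [Int.fract_lt_one t], ⌊t⌋, by
      rw [Int.fract]; ring⟩
  have fract_add : ∀ t, Int.fract t + θ < 1 → Int.fract (t + θ) = Int.fract t + θ := fun t h =>
    Int.fract_eq_iff.2 ⟨by linarith [Int.fract_nonneg t], h, ⌊t⌋, by rw [Int.fract]; ring⟩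
  have fract_add' : ∀ t, 1 ≤ Int.fract t + θ → Int.fract (t + θ) = Int.fract t + θ - 1 :=
    fun t h => Int.fract_eq_iff.2
      ⟨by linarith, by linarith [Int.fract_lt_one t], ⌊t⌋ + 1, by
        rw [Int.fract]; push_cast; ring⟩
  refine ⟨fun t => F (Int.fract t), fun t => G (Int.fract t), ?_, ?_, fun t => ?_, fun t => ?_,
    fun t => ⟨?_, ?_⟩, fun t => ?_, fun t => ?_, fun t => ?_, ?_⟩
  · refine hFc.continuousOn.comp_fract'' ?_
    rw [hFl hθ0.le, hFr (by linarith), ramp_of_nonpos hε le_rfl, ramp_of_le hε (by linarith),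
      sub_self]
  · refine hGc.continuousOn.comp_fract'' ?_
    rw [hGl hθ0.le, hGr (by linarith)]
  · simp only [Int.fract_add_one]
  · simp only [Int.fract_add_one]
  · exact sub_nonneg.2 (monotone_ramp hε (by linarith))
  · simp only [F]
    linarith [ramp_le_one ε (Int.fract t), ramp_nonneg ε (Int.fract t - θ)]
  · rcases le_total (Int.fract t) θ with h | h
    · simp only [hGl h, zero_mul]
    rcases le_total (θ + ε) (Int.fract t) with h' | h'
    · simp only [hGr h', zero_mul]
    · simp only [fract_sub t h, hGl (show Int.fract t - θ ≤ θ by linarith), mul_zero]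
  · rcases le_total (Int.fract t) θ with h | h
    · simp only [hGl h, zero_mul]
    rcases le_total (θ + ε) (Int.fract t) with h' | h'
    · simp only [hGr h', zero_mul]
    · simp only [fract_sub t h, hFr (hεθ.trans h), hFl (show Int.fract t - θ ≤ θ by linarith)]
      ring
  · have hx := hGβ (Int.fract t)
    rw [hβf] at hx
    simp only [hx]
    rcases le_total (Int.fract t) θ with h | h
    · have hy := hGβ (Int.fract t + θ)
      have hb := hβf t 0
      simp only [sub_zero] at hb
      rw [add_sub_cancel_right, hb] at hy
      rw [fract_add t (by linarith), hy, hFl h, ramp_of_nonpos hε (sub_nonpos.2 h)]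
      ring
    · have hy : G (Int.fract (t + θ)) = 0 := by
        rcases lt_or_ge (Int.fract t + θ) 1 with h' | h'
        · rw [fract_add t h', hGr (by linarith)]
        · rw [fract_add' t h', hGl (by linarith [Int.fract_lt_one t])]
      rw [hy, hFr (hεθ.trans h)]
      ring
  · rw [← intervalIntegral_ramp_sub_ramp hε hθ0.le (show θ + ε ≤ 1 by linarith)]
    refine intervalIntegral.integral_congr_Ioo_of_le zero_le_one fun x hx => ?_
    simp only [Int.fract_eq_self.2 ⟨hx.1.le, hx.2⟩, F]
end

section
/- Let A be a unital C*-algebra, θ ∈ (0,1) an irrational number, and u, w ∈ A unitary elements satisfying uw = e^{-2πiθ}wu. Let M, N ≥ 0 be integers and for each integer n with −M ≤ n ≤ N let c_n be an element of the closed *-subalgebra of A generated by w. Then for every integer k with −M ≤ k ≤ N, ‖u^k c_k‖ ≤ ‖Σ_{n=−M}^{N} u^n c_n‖, where u^n denotes (u*)^{−n} when n < 0. -/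
open Finset in
/-- An eigenvector component of modulus-one eigenvalue is bounded by the whole sum, for a
contraction whose other eigenvalues involved have modulus one and differ from it. -/
theorem norm_eigenvector_le_norm_sum {E ι : Type*} [NormedAddCommGroup E] [NormedSpace ℂ E]
    (T : E →ₗ[ℂ] E) (hT : ∀ x, ‖T x‖ ≤ ‖x‖) (s : Finset ι) (v : ι → E) (μ : ι → ℂ)
    (hv : ∀ i ∈ s, T (v i) = μ i • v i) (hμ : ∀ i ∈ s, ‖μ i‖ = 1) {k : ι} (hk : k ∈ s)
    (hne : ∀ i ∈ s, i ≠ k → μ i ≠ μ k) :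
    ‖v k‖ ≤ ‖∑ i ∈ s, v i‖ := by
  classical
  have hk0 : μ k ≠ 0 := by
    rw [← norm_ne_zero_iff, hμ k hk]
    exact one_ne_zero
  let S : E →ₗ[ℂ] E := (μ k)⁻¹ • T
  have hS (j : ℕ) (x : E) : ‖(S ^ j) x‖ ≤ ‖x‖ := by
    induction j with
    | zero => simp
    | succ j ih =>
      rw [pow_succ', Module.End.mul_apply]
      refine le_trans ?_ ih
      simpa [S, norm_smul, hμ k hk] using hT ((S ^ j) x)
  have hSv (j : ℕ) (i : ι) (hi : i ∈ s) : (S ^ j) (v i) = (μ i / μ k) ^ j • v i := by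
    induction j with
    | zero => simp
    | succ j ih =>
      rw [pow_succ', Module.End.mul_apply, ih, map_smul]
      simp only [S, LinearMap.smul_apply, hv i hi, smul_smul]
      congr 1
      ring
  have hgeom (J : ℕ) (i : ι) (hi : i ∈ s) (hik : i ≠ k) :
      ‖∑ j ∈ range J, (μ i / μ k) ^ j‖ ≤ 2 / ‖μ i / μ k - 1‖ := by
    have h1 : μ i / μ k ≠ 1 := fun h => hne i hi hik ((div_eq_one_iff_eq hk0).1 h)
    rw [geom_sum_eq h1, norm_div]
    gcongr
    refine (norm_sub_le _ _).trans (le_of_eq ?_)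
    rw [norm_pow, norm_div, hμ i hi, hμ k hk]
    norm_num
  have hsum (J : ℕ) : ∑ j ∈ range J, (S ^ j) (∑ i ∈ s, v i) =
      (J : ℂ) • v k + ∑ i ∈ s.erase k, (∑ j ∈ range J, (μ i / μ k) ^ j) • v i := by
    have hsw : ∑ j ∈ range J, (S ^ j) (∑ i ∈ s, v i) =
        ∑ i ∈ s, (∑ j ∈ range J, (μ i / μ k) ^ j) • v i := by
      simp_rw [map_sum, sum_smul]
      rw [sum_comm]
      exact sum_congr rfl fun i hi => sum_congr rfl fun j _ => hSv j i hi
    rw [hsw, ← add_sum_erase s _ hk]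
    simp [div_self hk0]
  set C : ℝ := ∑ i ∈ s.erase k, 2 / ‖μ i / μ k - 1‖ * ‖v i‖
  have hbound (J : ℕ) : J * ‖v k‖ ≤ J * ‖∑ i ∈ s, v i‖ + C := by
    have h1 : ‖∑ j ∈ range J, (S ^ j) (∑ i ∈ s, v i)‖ ≤ J * ‖∑ i ∈ s, v i‖ := by
      refine (norm_sum_le_of_le _ fun j _ => hS j _).trans (le_of_eq ?_)
      simp
    have h2 : ‖∑ i ∈ s.erase k, (∑ j ∈ range J, (μ i / μ k) ^ j) • v i‖ ≤ C := by
      refine norm_sum_le_of_le _ fun i hi => ?_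
      rw [norm_smul]
      gcongr
      exact hgeom J i (mem_of_mem_erase hi) (ne_of_mem_erase hi)
    have h3 : ‖(J : ℂ) • v k‖ = J * ‖v k‖ := by simp [norm_smul]
    rw [← h3, eq_sub_of_add_eq (hsum J).symm]
    exact (norm_sub_le _ _).trans (add_le_add h1 h2)
  by_contra! hlt
  obtain ⟨J, hJ⟩ := exists_nat_gt (C / (‖v k‖ - ‖∑ i ∈ s, v i‖))
  rw [div_lt_iff₀ (sub_pos.2 hlt)] at hJ
  linarith [hbound J, mul_sub (J : ℝ) ‖v k‖ ‖∑ i ∈ s, v i‖]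

/-- If `w u = z u w` with `u` unitary and `z ≠ 0`, then `w uⁿ = zⁿ uⁿ w` for every integer `n`. -/
theorem unitary.mul_coe_zpow_of_mul_eq_smul {A : Type*} [Ring A] [StarRing A] [Algebra ℂ A]
    (u : unitary A) (w : A) {z : ℂ} (hz : z ≠ 0) (h : w * u = z • ((u : A) * w)) (n : ℤ) :
    w * (↑(u ^ n) : A) = z ^ n • ((↑(u ^ n) : A) * w) := by
  have hinv : w * (↑(u⁻¹) : A) = z⁻¹ • ((↑(u⁻¹) : A) * w) := by
    have h1 : (↑(u⁻¹) : A) * u = 1 := by rw [← Submonoid.coe_mul]; simp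
    have h2 : (u : A) * (↑(u⁻¹) : A) = 1 := by rw [← Submonoid.coe_mul]; simp
    calc w * (↑(u⁻¹) : A)
        = z⁻¹ • ((↑(u⁻¹) : A) * (z • ((u : A) * w)) * (↑(u⁻¹) : A)) := by
          rw [mul_smul_comm, smul_mul_assoc, smul_smul, inv_mul_cancel₀ hz, one_smul,
            ← mul_assoc, h1, one_mul]
      _ = z⁻¹ • ((↑(u⁻¹) : A) * w) := by
          rw [← h, mul_assoc, mul_assoc, h2, mul_one]
  induction n with
  | zero => simp
  | succ n ih =>
    rw [zpow_add_one, zpow_add_one₀ hz, Submonoid.coe_mul, ← mul_assoc, ih, smul_mul_assoc,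
      mul_assoc, h, mul_smul_comm, smul_smul, mul_assoc]
  | pred n ih =>
    rw [zpow_sub_one, zpow_sub_one₀ hz, Submonoid.coe_mul, ← mul_assoc, ih, smul_mul_assoc,
      mul_assoc, hinv, mul_smul_comm, smul_smul, mul_assoc]

/-- The powers of `exp (2πiθ)` are pairwise distinct when `θ` is irrational. -/
theorem Irrational.exp_two_pi_mul_I_zpow_injective {θ : ℝ} (hθ : Irrational θ) :
    Function.Injective fun n : ℤ => Complex.exp (2 * Real.pi * Complex.I * θ) ^ n := by
  intro m n hmn
  simp only [← Complex.exp_int_mul] at hmn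
  obtain ⟨l, hl⟩ := Complex.exp_eq_exp_iff_exists_int.1 hmn
  have h1 : (2 * Real.pi * Complex.I : ℂ) ≠ 0 := Complex.two_pi_I_ne_zero
  have h2 : ((m - n : ℤ) : ℂ) * θ = l := by
    apply mul_left_cancel₀ h1
    push_cast
    linear_combination hl
  by_contra hne
  have h3 : ((m - n : ℤ) : ℝ) * θ = l := by exact_mod_cast h2
  exact (hθ.intCast_mul (sub_ne_zero.2 hne)).ne_int l h3


/-- Let A be a unital C*-algebra, θ ∈ (0,1) irrational, and u, w ∈ A
unitaries with uw = e^{-2πiθ}wu.  Let M, N ≥ 0 and for −M ≤ n ≤ N let cₙ lie in the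
closed *-subalgebra of A generated by w.  Then for every −M ≤ k ≤ N,
‖uᵏ c_k‖ ≤ ‖Σ_{n=−M}^{N} uⁿ cₙ‖ (where uⁿ = (u*)^{−n} for n < 0). -/
theorem stmt_7 {A : Type*} [NormedRing A] [StarRing A] [CStarRing A] [CompleteSpace A]
    [NormedAlgebra ℂ A] [StarModule ℂ A]
    (θ : ℝ) (hθ : θ ∈ Set.Ioo (0 : ℝ) 1) (hirr : Irrational θ)
    (u w : unitary A)
    (hrel : (u : A) * w = Complex.exp (-(2 * Real.pi * Complex.I * θ)) • ((w : A) * u))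
    (M N : ℕ) (c : ℤ → A)
    (hc : ∀ n ∈ Finset.Icc (-(M : ℤ)) (N : ℤ), c n ∈ StarAlgebra.elemental ℂ (w : A)) :
    ∀ k ∈ Finset.Icc (-(M : ℤ)) (N : ℤ),
      ‖(↑(u ^ k) : A) * c k‖ ≤
        ‖∑ n ∈ Finset.Icc (-(M : ℤ)) (N : ℤ), (↑(u ^ n) : A) * c n‖ := by
  intro k hk
  set z : ℂ := Complex.exp (2 * Real.pi * Complex.I * θ) with hzdef
  have hz : z ≠ 0 := Complex.exp_ne_zero _
  have hz1 : ‖z‖ = 1 := by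
    have : (2 * Real.pi * Complex.I * θ : ℂ) = ((2 * Real.pi * θ : ℝ) : ℂ) * Complex.I := by
      push_cast
      ring
    rw [hzdef, this, Complex.norm_exp_ofReal_mul_I]
  have hwu : (w : A) * u = z • ((u : A) * w) := by
    rw [hrel, smul_smul, hzdef, Complex.exp_neg, mul_inv_cancel₀ hz, one_smul]
  have hww : (w : A) * star (w : A) = 1 := Unitary.coe_mul_star_self w
  have hcomm (n : ℤ) (hn : n ∈ Finset.Icc (-(M : ℤ)) (N : ℤ)) : (w : A) * c n = c n * w := by
    have : IsStarNormal (w : A) := inferInstance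
    exact congrArg Subtype.val (mul_comm
      (⟨w, StarAlgebra.elemental.self_mem ℂ (w : A)⟩ : StarAlgebra.elemental ℂ (w : A))
      ⟨c n, hc n hn⟩)
  refine norm_eigenvector_le_norm_sum
    (LinearMap.mulLeft ℂ (w : A) ∘ₗ LinearMap.mulRight ℂ (star (w : A))) (fun x => ?_) _
    (fun n => (↑(u ^ n) : A) * c n) (fun n => z ^ n) (fun n hn => ?_)
    (fun n _ => by rw [norm_zpow, hz1, one_zpow]) hk
    (fun n _ hnk h => hnk (hirr.exp_two_pi_mul_I_zpow_injective h))
  · have : star (w : A) = ((w⁻¹ : unitary A) : A) := rfl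
    simp [this, CStarRing.norm_coe_unitary_mul, CStarRing.norm_mul_coe_unitary]
  · simp only [LinearMap.comp_apply, LinearMap.mulLeft_apply, LinearMap.mulRight_apply]
    calc (w : A) * ((↑(u ^ n) : A) * c n * star (w : A))
        = ((w : A) * (↑(u ^ n) : A)) * c n * star (w : A) := by simp only [mul_assoc]
      _ = z ^ n • ((↑(u ^ n) : A) * ((w : A) * c n) * star (w : A)) := by
          rw [unitary.mul_coe_zpow_of_mul_eq_smul u w hz hwu]
          simp only [smul_mul_assoc, mul_assoc]
      _ = z ^ n • ((↑(u ^ n) : A) * c n) := by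
          rw [hcomm n hn, mul_assoc, mul_assoc, hww, mul_one]
end

section
/- Let A be a unital C*-algebra, θ ∈ (0,1) an irrational number, and u, v ∈ A unitary elements satisfying vu = e^{2πiθ}uv, such that the spectrum of u*v equals the full unit circle 𝕋. Then for every λ > 0 and every positive integer n, ‖(u + λv)^n‖² = max_{x ∈ [0,1]} ∏_{k=0}^{n−1} (1 + λ² + 2λ cos(2π(x + kθ))). -/
lemma one_add_smul_mul_comm {A : Type*} [Ring A] [Algebra ℂ A] {u w : A} {q : ℂ}
    (h : w * u = q • (u * w)) (c : ℂ) :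
    (1 + c • w) * u = u * (1 + (c * q) • w) := by
  simp [add_mul, mul_add, h, smul_smul]

/-- `u` can be moved past a product of factors `1 + c q ^ k w` at the cost of rescaling `w`. -/
lemma prod_one_add_smul_mul_comm {A : Type*} [Ring A] [Algebra ℂ A] {u w : A} {q : ℂ}
    (h : w * u = q • (u * w)) (c : ℂ) (n : ℕ) :
    Polynomial.aeval w (∏ k ∈ Finset.range n, (1 + Polynomial.C (c * q ^ k) * Polynomial.X)) * u =
      u * Polynomial.aeval w
        (∏ k ∈ Finset.range n, (1 + Polynomial.C (c * q ^ (k + 1)) * Polynomial.X)) := by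
  induction n with
  | zero => simp
  | succ n ih =>
    have key := one_add_smul_mul_comm h (c * q ^ n)
    have e (d : ℂ) : Polynomial.aeval w (1 + Polynomial.C d * Polynomial.X) = 1 + d • w := by
      simp [Algebra.smul_def]
    rw [Finset.prod_range_succ, Finset.prod_range_succ, map_mul (Polynomial.aeval w),
      map_mul (Polynomial.aeval w), mul_assoc, e, e, key, ← mul_assoc, ih, mul_assoc,
      pow_succ, mul_assoc c]

/-- Powers of `u * (1 + c • w)` when `w * u = q • (u * w)`. -/
lemma mul_one_add_smul_pow {A : Type*} [Ring A] [Algebra ℂ A] {u w : A} {q : ℂ}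
    (h : w * u = q • (u * w)) (c : ℂ) (n : ℕ) :
    (u * (1 + c • w)) ^ n = u ^ n * Polynomial.aeval w
      (∏ k ∈ Finset.range n, (1 + Polynomial.C (c * q ^ k) * Polynomial.X)) := by
  induction n with
  | zero => simp
  | succ n ih =>
    rw [pow_succ, ih, Finset.prod_range_succ', map_mul, ← mul_assoc, mul_assoc (u ^ n),
      prod_one_add_smul_mul_comm h, pow_succ u, mul_assoc, mul_assoc, mul_assoc]
    simp [Algebra.smul_def]

lemma commute_aeval {R A : Type*} [CommSemiring R] [Semiring A] [Algebra R A] {a b : A}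
    (h : Commute b a) (p : Polynomial R) : Commute b (Polynomial.aeval a p) := by
  induction p using Polynomial.induction_on' with
  | add p q hp hq => simpa using hp.add_right hq
  | monomial n c =>
    rw [Polynomial.aeval_monomial]
    exact (Algebra.commute_algebraMap_right c b).mul_right (h.pow_right n)

lemma isStarNormal_aeval {R A : Type*} [CommSemiring R] [Semiring A] [StarRing A] [Algebra R A]
    (a : A) [IsStarNormal a] (p : Polynomial R) : IsStarNormal (Polynomial.aeval a p) := by
  have h := commute_aeval (star_comm_self' a : Commute (star a) a) p
  refine ⟨commute_aeval ?_ p⟩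
  simpa using h.star_star.symm

lemma spectralRadius_eq_nnnorm_of_isStarNormal {A : Type*} [NormedRing A] [StarRing A]
    [CStarRing A] [CompleteSpace A] [NormedAlgebra ℂ A] [StarModule ℂ A] (a : A)
    [IsStarNormal a] : spectralRadius ℂ a = ‖a‖₊ :=
  letI : CStarAlgebra A := { }
  IsStarNormal.spectralRadius_eq_nnnorm a

/-- The squared modulus of a factor at the point `exp (2πix)` of the unit circle. -/
lemma norm_one_add_mul_exp_sq (lam θ x : ℝ) (k : ℕ) :
    ‖1 + (lam : ℂ) * Complex.exp (2 * Real.pi * Complex.I * θ) ^ k *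
      Complex.exp (2 * Real.pi * x * Complex.I)‖ ^ 2 =
      1 + lam ^ 2 + 2 * lam * Real.cos (2 * Real.pi * (x + k * θ)) := by
  have h : Complex.exp (2 * Real.pi * Complex.I * θ) ^ k *
      Complex.exp (2 * Real.pi * x * Complex.I) =
      Complex.exp ((2 * Real.pi * (x + k * θ) : ℝ) * Complex.I) := by
    rw [← Complex.exp_nat_mul, ← Complex.exp_add]
    congr 1
    push_cast
    ring
  rw [mul_assoc, h, Complex.exp_mul_I, ← Complex.ofReal_cos, ← Complex.ofReal_sin,
    Complex.sq_norm, Complex.normSq_apply]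
  simp only [Complex.add_re, Complex.add_im, Complex.mul_re, Complex.mul_im, Complex.one_re,
    Complex.one_im, Complex.ofReal_re, Complex.ofReal_im, Complex.I_re, Complex.I_im]
  nlinarith [Real.sin_sq_add_cos_sq (2 * Real.pi * (x + k * θ))]

/-- Every point of the unit circle is `exp (2πix)` with `x ∈ [0,1]`. -/
lemma exists_mem_Icc_exp_eq {z : ℂ} (hz : z ∈ Metric.sphere (0 : ℂ) 1) :
    ∃ x ∈ Set.Icc (0 : ℝ) 1, Complex.exp (2 * Real.pi * x * Complex.I) = z := by
  have hz1 : ‖z‖ = 1 := by simpa using hz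
  refine ⟨Int.fract (z.arg / (2 * Real.pi)), ⟨Int.fract_nonneg _, (Int.fract_lt_one _).le⟩, ?_⟩
  have h := Complex.norm_mul_exp_arg_mul_I z
  rw [hz1, Complex.ofReal_one, one_mul] at h
  rw [← Int.self_sub_floor]
  refine Eq.trans ?_ h
  rw [Complex.exp_eq_exp_iff_exists_int]
  refine ⟨-⌊z.arg / (2 * Real.pi)⌋, ?_⟩
  push_cast
  field_simp
  ring

/-- Let A be a unital C*-algebra, θ ∈ (0,1) irrational, u, v ∈ A unitaries
with vu = e^{2πiθ}uv and σ(u*v) = 𝕋.  Then for every λ > 0 and every positive integer n,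
‖(u + λv)ⁿ‖² = max_{x∈[0,1]} ∏_{k=0}^{n−1} (1 + λ² + 2λ cos(2π(x + kθ))). -/
theorem stmt_11 {A : Type*} [NormedRing A] [StarRing A] [CStarRing A] [CompleteSpace A]
    [NormedAlgebra ℂ A] [StarModule ℂ A]
    (θ : ℝ) (hθ : θ ∈ Set.Ioo (0 : ℝ) 1) (hirr : Irrational θ)
    (u v : A) (hu : u ∈ unitary A) (hv : v ∈ unitary A)
    (hrel : v * u = Complex.exp (2 * Real.pi * Complex.I * θ) • (u * v))
    (hspec : spectrum ℂ (star u * v) = Metric.sphere (0 : ℂ) 1)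
    (lam : ℝ) (hlam : 0 < lam) (n : ℕ) (hn : 0 < n) :
    ‖(u + (lam : ℂ) • v) ^ n‖ ^ 2 =
      sSup ((fun x : ℝ => ∏ k ∈ Finset.range n,
        (1 + lam ^ 2 + 2 * lam * Real.cos (2 * Real.pi * (x + k * θ)))) '' Set.Icc (0 : ℝ) 1) := by
  set q := Complex.exp (2 * Real.pi * Complex.I * θ)
  set w := star u * v with hw
  have huw : u * w = v := by
    rw [hw, ← mul_assoc, (Unitary.mem_iff.mp hu).2, one_mul]
  have hwmem : w ∈ unitary A := mul_mem (Unitary.star_mem hu) hv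
  have hwn : IsStarNormal w := ⟨by
    rw [Commute, SemiconjBy, (Unitary.mem_iff.mp hwmem).1, (Unitary.mem_iff.mp hwmem).2]⟩
  have hwu : w * u = q • (u * w) := by
    rw [huw, hw, mul_assoc, hrel, mul_smul_comm, ← mul_assoc, (Unitary.mem_iff.mp hu).1, one_mul]
  have : Nontrivial A := by
    by_contra hA
    rw [not_nontrivial_iff_subsingleton] at hA
    have h1 : (1 : ℂ) ∈ spectrum ℂ w := by rw [hspec]; simp
    simp [spectrum.of_subsingleton] at h1
  set p : Polynomial ℂ :=
    ∏ k ∈ Finset.range n, (1 + Polynomial.C (lam * q ^ k) * Polynomial.X) with hp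
  have hpow : (u + (lam : ℂ) • v) ^ n = u ^ n * Polynomial.aeval w p := by
    rw [hp, ← mul_one_add_smul_pow hwu, mul_add, mul_one, mul_smul_comm, huw]
  rw [hpow, CStarRing.norm_mem_unitary_mul _ (pow_mem hu n)]
  have hnormal := isStarNormal_aeval w p
  have heval (x : ℝ) : ‖p.eval (Complex.exp (2 * Real.pi * x * Complex.I))‖ ^ 2 =
      ∏ k ∈ Finset.range n,
        (1 + lam ^ 2 + 2 * lam * Real.cos (2 * Real.pi * (x + k * θ))) := by
    simp only [hp, Polynomial.eval_prod, norm_prod, ← Finset.prod_pow]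
    refine Finset.prod_congr rfl fun k _ => ?_
    simpa using norm_one_add_mul_exp_sq lam θ x k
  have hσ : spectrum ℂ (Polynomial.aeval w p) =
      (fun z => p.eval z) '' Metric.sphere (0 : ℂ) 1 := by
    rw [spectrum.map_polynomial_aeval, hspec]
  symm
  apply IsGreatest.csSup_eq
  constructor
  · obtain ⟨y, hy, hynorm⟩ := spectrum.exists_nnnorm_eq_spectralRadius (Polynomial.aeval w p)
    rw [spectralRadius_eq_nnnorm_of_isStarNormal, ENNReal.coe_inj] at hynorm
    rw [hσ] at hy
    obtain ⟨z, hz, rfl⟩ := hy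
    obtain ⟨x, hx, rfl⟩ := exists_mem_Icc_exp_eq hz
    refine ⟨x, hx, ?_⟩
    dsimp only
    rw [← heval, ← coe_nnnorm, ← coe_nnnorm, hynorm]
  · rintro _ ⟨x, -, rfl⟩
    dsimp only
    rw [← heval]
    gcongr
    apply spectrum.norm_le_norm_of_mem
    rw [hσ]
    refine ⟨_, ?_, rfl⟩
    rw [mem_sphere_zero_iff_norm]
    exact_mod_cast Complex.norm_exp_ofReal_mul_I (2 * Real.pi * x)
end

section
/- Let A be a unital C*-algebra, θ ∈ (0,1) an irrational number, and u, v ∈ A unitary elements satisfying vu = e^{2πiθ}uv, such that the spectrum of u*v equals the full unit circle 𝕋. Then for every real λ with 0 < λ ≤ 1, the spectral radius of u + λv equals 1. -/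
open Polynomial in
/-- `log (1 + ρ z)` is uniformly approximated on the circle by polynomials without constant term. -/
lemma exists_polynomial_norm_one_add_le_of_lt_one {ρ : ℝ} (hρ0 : 0 ≤ ρ) (hρ1 : ρ < 1)
    {ε : ℝ} (hε : 0 < ε) :
    ∃ P : ℂ[X], P.coeff 0 = 0 ∧ ∀ z : ℂ, ‖z‖ = 1 →
      ‖1 + (ρ : ℂ) * z‖ ≤ Real.exp ε * ‖Complex.exp (P.eval z)‖ := by
  obtain ⟨n, hn⟩ : ∃ n : ℕ, ρ ^ (n + 1) * (1 - ρ)⁻¹ / (n + 1) ≤ ε := by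
    have h1 : Filter.Tendsto (fun n : ℕ => ρ ^ (n + 1) * (1 - ρ)⁻¹) Filter.atTop (nhds 0) := by
      simpa using (((tendsto_pow_atTop_nhds_zero_of_lt_one hρ0 hρ1).comp
        (Filter.tendsto_add_atTop_nat 1)).mul_const (1 - ρ)⁻¹)
    obtain ⟨n, hn⟩ := (h1.eventually (gt_mem_nhds hε)).exists
    refine ⟨n, le_trans (div_le_self ?_ ?_) hn.le⟩
    · have : 0 < 1 - ρ := by linarith
      positivity
    · simp
  refine ⟨∑ j ∈ Finset.range (n + 1), C ((-1) ^ (j + 1) * (ρ : ℂ) ^ j / j) * X ^ j, ?_, ?_⟩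
  · simp [coeff_X_pow]
  · intro z hz
    have hw : ‖(ρ : ℂ) * z‖ = ρ := by simp [hz, abs_of_nonneg hρ0]
    have hb := Complex.norm_log_sub_logTaylor_le n (z := (ρ : ℂ) * z) (by rwa [hw])
    rw [hw] at hb
    have heval : (∑ j ∈ Finset.range (n + 1),
        C ((-1) ^ (j + 1) * (ρ : ℂ) ^ j / j) * X ^ j).eval z =
        Complex.logTaylor (n + 1) ((ρ : ℂ) * z) := by
      simp only [eval_finsetSum, eval_mul, eval_C, eval_pow, eval_X, Complex.logTaylor]
      exact Finset.sum_congr rfl fun j _ => by rw [mul_pow]; ring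
    have hne : 1 + (ρ : ℂ) * z ≠ 0 := by
      intro h
      have : (ρ : ℂ) * z = -1 := by linear_combination h
      rw [this] at hw
      simp at hw
      linarith
    rw [heval]
    nth_rewrite 1 [← Complex.exp_log hne]
    rw [Complex.norm_exp, Complex.norm_exp, ← Real.exp_add, Real.exp_le_exp]
    have := (Complex.re_le_norm _).trans (hb.trans hn)
    rw [Complex.sub_re] at this
    linarith

lemma one_add_mul_norm_one_add_le {lam r : ℝ} (h0 : 0 ≤ lam) (h1 : lam ≤ 1) (hr0 : 0 ≤ r)
    (hr1 : r ≤ 1) {z : ℂ} (hz : ‖z‖ = 1) :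
    (1 + r) * ‖1 + (lam : ℂ) * z‖ ≤ 2 * ‖1 + ((r * lam : ℝ) : ℂ) * z‖ := by
  have key : ∀ t : ℝ, ‖1 + (t : ℂ) * z‖ ^ 2 = 1 + t ^ 2 + 2 * t * z.re := by
    intro t
    have hz2 : z.re * z.re + z.im * z.im = 1 := by
      rw [← Complex.normSq_apply, Complex.normSq_eq_norm_sq, hz]; norm_num
    rw [← Complex.normSq_eq_norm_sq, Complex.normSq_apply]
    simp
    linear_combination t ^ 2 * hz2
  have hc := (abs_le.mp ((Complex.abs_re_le_norm z).trans hz.le))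
  refine abs_le_of_sq_le_sq' ?_ (by positivity) |>.2
  rw [mul_pow, mul_pow, key, key]
  have hA : (1 + r) * (1 + lam) ≤ 2 * (1 + r * lam) := by
    nlinarith [mul_nonneg (sub_nonneg.2 h1) (sub_nonneg.2 hr1)]
  have hB : (1 + r) * (1 - lam) ≤ 2 * (1 - r * lam) := by
    nlinarith [mul_nonneg (sub_nonneg.2 hr1) (by linarith : 0 ≤ 1 + lam)]
  have hA2 := pow_le_pow_left₀ (by positivity) hA 2
  have hB2 := pow_le_pow_left₀ (mul_nonneg (by linarith) (by linarith)) hB 2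
  nlinarith [mul_le_mul_of_nonneg_left hA2 (by linarith : 0 ≤ 1 + z.re),
    mul_le_mul_of_nonneg_left hB2 (by linarith : 0 ≤ 1 - z.re)]

open Polynomial in
lemma exists_polynomial_norm_one_add_le {lam : ℝ} (h0 : 0 ≤ lam) (h1 : lam ≤ 1)
    {ε : ℝ} (hε : 0 < ε) :
    ∃ P : ℂ[X], P.coeff 0 = 0 ∧ ∀ z : ℂ, ‖z‖ = 1 →
      ‖1 + (lam : ℂ) * z‖ ≤ Real.exp (2 * ε) * ‖Complex.exp (P.eval z)‖ := by
  have hr1 : Real.exp (-ε) < 1 := by simpa using hε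
  have hr0 := Real.exp_pos (-ε)
  obtain ⟨P, hP0, hP⟩ := exists_polynomial_norm_one_add_le_of_lt_one
    (ρ := Real.exp (-ε) * lam) (by positivity) (by nlinarith) hε
  refine ⟨P, hP0, fun z hz => ?_⟩
  have h2 := one_add_mul_norm_one_add_le h0 h1 hr0.le hr1.le hz
  have h3 := hP z hz
  have h4 : Real.exp (-ε) * ‖1 + (lam : ℂ) * z‖ ≤ Real.exp ε * ‖Complex.exp (P.eval z)‖ := by
    nlinarith [norm_nonneg (1 + (lam : ℂ) * z)]
  calc ‖1 + (lam : ℂ) * z‖ = Real.exp ε * (Real.exp (-ε) * ‖1 + (lam : ℂ) * z‖) := by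
        rw [← mul_assoc, ← Real.exp_add]; simp
    _ ≤ Real.exp ε * (Real.exp ε * ‖Complex.exp (P.eval z)‖) := by gcongr
    _ = _ := by rw [← mul_assoc, ← Real.exp_add, two_mul]

open Polynomial in
/-- The cohomological equation for the rotation by `q`, for polynomials. -/
lemma Polynomial.exists_comp_C_mul_X_sub_eq {K : Type*} [Field K] {q : K}
    (hq : ∀ n : ℕ, n ≠ 0 → q ^ n ≠ 1) {P : K[X]} (hP : P.coeff 0 = 0) :
    ∃ H : K[X], H.comp (C q * X) - H = P := by
  refine ⟨P.sum fun m a => monomial m (a / (q ^ m - 1)), ?_⟩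
  have hcoeff : ∀ n, (P.sum fun m a => monomial m (a / (q ^ m - 1))).coeff n =
      P.coeff n / (q ^ n - 1) := by
    intro n
    simp +contextual [Polynomial.sum_def, finsetSum_coeff, coeff_monomial]
  ext n
  rw [coeff_sub, comp_C_mul_X_coeff, hcoeff]
  rcases eq_or_ne n 0 with rfl | hn
  · simp [hP]
  · have := sub_ne_zero.2 (hq n hn)
    field_simp

open Polynomial in
lemma Polynomial.aeval_mul_eq_mul_aeval_comp {R A : Type*} [CommRing R] [Ring A] [Algebra R A]
    {q : R} {u w : A} (h : w * u = q • (u * w)) (P : R[X]) :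
    aeval w P * u = u * aeval w (P.comp (C q * X)) := by
  induction P using Polynomial.induction_on' with
  | add p r hp hr => simp only [map_add, add_mul, mul_add, add_comp, hp, hr]
  | monomial n a =>
    have hn : w ^ n * u = q ^ n • (u * w ^ n) := by
      induction n with
      | zero => simp
      | succ n ih =>
        rw [pow_succ, mul_assoc, h, mul_smul_comm, ← mul_assoc, ih, smul_mul_assoc, smul_smul,
          mul_assoc, pow_succ']
    simp only [aeval_comp, aeval_monomial, map_mul, aeval_C, aeval_X, ← Algebra.smul_def,
      mul_smul_comm, smul_mul_assoc]
    rw [hn, _root_.smul_pow, mul_smul_comm]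

open Polynomial in
lemma one_le_norm_aeval_of_spectrum_eq_sphere {A : Type*} [CStarAlgebra A] [Nontrivial A] {w : A}
    (hw : spectrum ℂ w = Metric.sphere (0 : ℂ) 1) {p : ℂ[X]} (hp : p.eval 0 = 1) :
    1 ≤ ‖aeval w p‖ := by
  have h := Complex.norm_le_of_forall_mem_frontier_norm_le (f := fun z => p.eval z)
    (U := Metric.ball (0 : ℂ) 1) (C := ‖aeval w p‖) Metric.isBounded_ball
    p.differentiable.diffContOnCl (fun z hz => ?_) (z := 0) (subset_closure (by simp))
  · simpa [hp] using h
  · rw [frontier_ball _ one_ne_zero, ← hw] at hz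
    exact spectrum.norm_le_norm_of_mem (spectrum.subset_polynomial_aeval w p ⟨z, hz, rfl⟩)

open Polynomial in
lemma one_le_spectralRadius_mul_one_add {A : Type*} [CStarAlgebra A] [Nontrivial A] {q : ℂ}
    {u w : A} (hu : u ∈ unitary A) (h : w * u = q • (u * w))
    (hw : spectrum ℂ w = Metric.sphere (0 : ℂ) 1) (c : ℂ) :
    1 ≤ spectralRadius ℂ (u * (1 + c • w)) := by
  have hpow : ∀ n : ℕ, ∃ p : ℂ[X], p.eval 0 = 1 ∧
      (u * (1 + c • w)) ^ n = u ^ n * aeval w p := by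
    intro n
    induction n with
    | zero => exact ⟨1, by simp⟩
    | succ n ih =>
      obtain ⟨p, hp, hpn⟩ := ih
      refine ⟨p.comp (C q * X) * (1 + C c * X), by simp [hp], ?_⟩
      rw [pow_succ, hpn, mul_assoc, ← mul_assoc _ u, aeval_mul_eq_mul_aeval_comp h, pow_succ]
      simp only [map_mul, map_add, map_one, aeval_C, aeval_X, Algebra.smul_def, mul_assoc]
  refine ge_of_tendsto' (spectrum.pow_nnnorm_pow_one_div_tendsto_nhds_spectralRadius _)
    fun n => ?_
  obtain ⟨p, hp, hpn⟩ := hpow n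
  rw [← ENNReal.one_rpow (1 / n : ℝ)]
  refine ENNReal.rpow_le_rpow ?_ (by positivity)
  rw [hpn, ENNReal.one_le_coe_iff, ← NNReal.coe_le_coe, NNReal.coe_one, coe_nnnorm,
    CStarRing.norm_mem_unitary_mul _ (pow_mem hu n)]
  exact one_le_norm_aeval_of_spectrum_eq_sphere hw hp

open Polynomial in
lemma spectralRadius_mul_one_add_le_one {A : Type*} [CStarAlgebra A] [Nontrivial A] {q : ℂ}
    (hq : ∀ n : ℕ, n ≠ 0 → q ^ n ≠ 1) {u w : A} (hu : u ∈ unitary A) (hw : w ∈ unitary A)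
    (h : w * u = q • (u * w)) {lam : ℝ} (h0 : 0 ≤ lam) (h1 : lam ≤ 1) :
    spectralRadius ℂ (u * (1 + (lam : ℂ) • w)) ≤ 1 := by
  have hnormal : IsStarNormal w := ⟨by
    rw [commute_iff_eq, (Unitary.mem_iff.1 hw).1, (Unitary.mem_iff.1 hw).2]⟩
  have hsp : ∀ z ∈ spectrum ℂ w, ‖z‖ = 1 := fun z hz => by
    simpa using spectrum.subset_circle_of_unitary hw hz
  have hbound : ∀ ε : ℝ, 0 < ε →
      spectralRadius ℂ (u * (1 + (lam : ℂ) • w)) ≤ ENNReal.ofReal (Real.exp (2 * ε)) := by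
    intro ε hε
    obtain ⟨P, hP0, hP⟩ := exists_polynomial_norm_one_add_le h0 h1 hε
    obtain ⟨H, hH⟩ := Polynomial.exists_comp_C_mul_X_sub_eq hq (P := -P) (by simp [hP0])
    let +nondep : NormedAlgebra ℚ A := .restrictScalars ℚ ℂ A
    set x := aeval w H with hx
    set y := aeval w (H.comp (C q * X)) with hy
    have hyx : y - x = aeval w (-P) := by rw [hx, hy, ← map_sub, hH]
    let U : Aˣ := Unitary.toUnits ⟨u, hu⟩
    have hconj : NormedSpace.exp x * u = u * NormedSpace.exp y := by
      have hxy : y = ↑U⁻¹ * x * (U : A) := by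
        rw [mul_assoc, Units.eq_inv_mul_iff_mul_eq]
        exact (aeval_mul_eq_mul_aeval_comp h H).symm
      rw [hxy, NormedSpace.exp_units_conj']
      change _ = (U : A) * _
      simp only [mul_assoc, Units.mul_inv_cancel_left]
      rfl
    have hyl : Commute (NormedSpace.exp y) (1 + (lam : ℂ) • w) := by
      have : Commute y (1 + (lam : ℂ) • w) := by
        have h2 : (1 + (lam : ℂ) • w) = aeval w (1 + C (lam : ℂ) * X) := by
          simp [Algebra.smul_def]
        rw [h2, hy, commute_iff_eq, ← map_mul, ← map_mul, mul_comm]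
      exact this.exp_left
    have hxy : Commute y (-x) := by
      rw [hy, hx, ← map_neg, commute_iff_eq, ← map_mul, ← map_mul, mul_comm]
    have hxx : NormedSpace.exp x * NormedSpace.exp (-x) = 1 := by
      rw [← NormedSpace.exp_add_of_commute ((Commute.refl x).neg_right)]; simp
    have hxx' : NormedSpace.exp (-x) * NormedSpace.exp x = 1 := by
      rw [← NormedSpace.exp_add_of_commute ((Commute.refl x).neg_left)]; simp
    let E : Aˣ := ⟨NormedSpace.exp x, NormedSpace.exp (-x), hxx, hxx'⟩
    have hE : (E : A) * (u * (1 + (lam : ℂ) • w)) * ↑E⁻¹ =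
        u * ((1 + (lam : ℂ) • w) * NormedSpace.exp (aeval w (-P))) := by
      change NormedSpace.exp x * _ * NormedSpace.exp (-x) = _
      rw [← mul_assoc, hconj, mul_assoc u, hyl.eq, ← hyx, sub_eq_add_neg,
        NormedSpace.exp_add_of_commute hxy]
      simp only [mul_assoc]
    have hcfc : (1 + (lam : ℂ) • w) * NormedSpace.exp (aeval w (-P)) =
        cfc (fun z : ℂ => (1 + (lam : ℂ) * z) * Complex.exp ((-P).eval z)) w := by
      have hn2 : IsStarNormal (aeval w (-P)) := by
        rw [← cfc_polynomial (-P) w]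
        exact cfc_predicate _ _
      rw [cfc_mul (fun z : ℂ => 1 + (lam : ℂ) * z) (fun z => Complex.exp ((-P).eval z)) w,
        cfc_comp_polynomial (-P) Complex.exp w, CFC.complex_exp_eq_normedSpace_exp,
        cfc_const_add .., cfc_const_mul_id .., map_one]
    have hr : spectralRadius ℂ (u * (1 + (lam : ℂ) • w)) = spectralRadius ℂ
        (u * ((1 + (lam : ℂ) • w) * NormedSpace.exp (aeval w (-P)))) := by
      rw [← hE]
      simp only [spectralRadius, spectrum.units_conjugate]
    rw [hr]
    refine (spectrum.spectralRadius_le_nnnorm _).trans ?_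
    rw [← ENNReal.ofReal_coe_nnreal, coe_nnnorm, CStarRing.norm_mem_unitary_mul _ hu, hcfc]
    refine ENNReal.ofReal_le_ofReal (norm_cfc_le (Real.exp_pos _).le fun z hz => ?_)
    have := hP z (hsp z hz)
    rw [eval_neg, Complex.exp_neg, ← div_eq_mul_inv, norm_div]
    exact (div_le_iff₀ (norm_pos_iff.2 (Complex.exp_ne_zero _))).2 this
  have hlim : Filter.Tendsto (fun ε : ℝ => ENNReal.ofReal (Real.exp (2 * ε)))
      (nhdsWithin 0 (Set.Ioi 0)) (nhds 1) := by
    have : Continuous fun ε : ℝ => ENNReal.ofReal (Real.exp (2 * ε)) :=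
      ENNReal.continuous_ofReal.comp (by fun_prop)
    simpa using (this.tendsto 0).mono_left nhdsWithin_le_nhds
  exact ge_of_tendsto hlim (Filter.eventually_of_mem self_mem_nhdsWithin hbound)

lemma Complex.exp_two_pi_mul_I_mul_pow_ne_one {θ : ℝ} (hirr : Irrational θ) {n : ℕ}
    (hn : n ≠ 0) : Complex.exp (2 * Real.pi * Complex.I * θ) ^ n ≠ 1 := by
  rw [← Complex.exp_nat_mul, Ne, Complex.exp_eq_one_iff]
  rintro ⟨m, hm⟩
  have h2 : (n : ℂ) * θ = m := by
    have := Complex.two_pi_I_ne_zero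
    apply mul_right_cancel₀ this
    linear_combination hm
  have h3 : (n : ℝ) * θ = m := by exact_mod_cast h2
  exact (hirr.natCast_mul hn).ne_int m h3

/-- Let A be a unital C*-algebra, θ ∈ (0,1) irrational, u, v ∈ A unitaries
with vu = e^{2πiθ}uv and σ(u*v) = 𝕋.  Then for every 0 < λ ≤ 1, the spectral radius of
u + λv equals 1. -/
theorem stmt_12 {A : Type*} [NormedRing A] [StarRing A] [CStarRing A] [CompleteSpace A]
    [NormedAlgebra ℂ A] [StarModule ℂ A]
    (θ : ℝ) (hθ : θ ∈ Set.Ioo (0 : ℝ) 1) (hirr : Irrational θ)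
    (u v : A) (hu : u ∈ unitary A) (hv : v ∈ unitary A)
    (hrel : v * u = Complex.exp (2 * Real.pi * Complex.I * θ) • (u * v))
    (hspec : spectrum ℂ (star u * v) = Metric.sphere (0 : ℂ) 1)
    (lam : ℝ) (h0 : 0 < lam) (h1 : lam ≤ 1) :
    spectralRadius ℂ (u + (lam : ℂ) • v) = 1 := by
  let _ : CStarAlgebra A := {}
  have hnt : Nontrivial A := by
    by_contra hA
    rw [not_nontrivial_iff_subsingleton] at hA
    have h1 : (1 : ℂ) ∈ spectrum ℂ (star u * v) := by rw [hspec]; simp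
    rw [spectrum.of_subsingleton] at h1
    exact h1
  have huu : u * star u = 1 := (Unitary.mem_iff.1 hu).2
  have huu' : star u * u = 1 := (Unitary.mem_iff.1 hu).1
  have hw : star u * v ∈ unitary A := mul_mem (Unitary.star_mem hu) hv
  have hT : u + (lam : ℂ) • v = u * (1 + (lam : ℂ) • (star u * v)) := by
    rw [mul_add, mul_one, mul_smul_comm, ← mul_assoc, huu, one_mul]
  have hcomm : (star u * v) * u =
      Complex.exp (2 * Real.pi * Complex.I * θ) • (u * (star u * v)) := by
    rw [mul_assoc, hrel, mul_smul_comm, ← mul_assoc, ← mul_assoc, huu, huu']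
  rw [hT]
  exact le_antisymm
    (spectralRadius_mul_one_add_le_one
      (fun n hn => Complex.exp_two_pi_mul_I_mul_pow_ne_one hirr hn) hu hw hcomm h0.le h1)
    (one_le_spectralRadius_mul_one_add hu hcomm hspec _)
end

section
/- Let A be a unital C*-algebra, θ ∈ (0,1) an irrational number, and u, v ∈ A unitary elements satisfying vu = e^{2πiθ}uv. Then for every λ > 0 the spectrum of u + λv is invariant under all rotations: for every ζ ∈ ℂ with |ζ| = 1, one has ζ·σ(u + λv) = σ(u + λv). -/
open scoped Pointwise in
/-- In a unital algebra, if conjugation by a unit multiplies `a` by the scalar unit `c`, then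
membership in the spectrum of `a` is preserved and reflected by multiplication by `c`. -/
theorem spectrum.mul_mem_iff_of_conj_eq_smul {R A : Type*} [CommRing R] [Ring A] [Algebra R A]
    {a : A} (w : Aˣ) (c : Rˣ) (h : (w : A) * a * (↑w⁻¹ : A) = (c : R) • a) (z : R) :
    (c : R) * z ∈ spectrum R a ↔ z ∈ spectrum R a := by
  have h' : spectrum R ((c : R) • a) = spectrum R a := by
    rw [← h, spectrum.units_conjugate]
  have h'' : spectrum R ((c : R) • a) = c • spectrum R a := spectrum.unit_smul_eq_smul a c
  rw [h'] at h''
  conv_lhs => rw [h'']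
  exact Set.smul_mem_smul_set_iff (a := c)

/-- Conjugation by `u⁻¹ * v` scales both `u` and `v` by `q` when `v * u = q • (u * v)`. -/
theorem Units.inv_mul_conj_add_smul {R A : Type*} [CommRing R] [Ring A] [Algebra R A]
    (u v : Aˣ) (q l : R) (h : (v : A) * u = q • ((u : A) * v)) :
    (↑(u⁻¹ * v) : A) * (u + l • (v : A)) * (↑(u⁻¹ * v)⁻¹ : A) = q • ((u : A) + l • (v : A)) := by
  have huv : (↑u⁻¹ : A) * v = q • ((v : A) * ↑u⁻¹) := by
    rw [Units.inv_mul_eq_iff_eq_mul, mul_smul_comm, ← mul_assoc, ← smul_mul_assoc, ← h,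
      Units.mul_inv_cancel_right]
  have hu : (↑u⁻¹ : A) * v * u = q • (v : A) := by
    rw [mul_assoc, h, mul_smul_comm, Units.inv_mul_cancel_left]
  have hv : (↑u⁻¹ : A) * v * v = q • ((v : A) * (↑u⁻¹ * v)) := by
    rw [huv, smul_mul_assoc, mul_assoc, huv]
  rw [Units.mul_inv_eq_iff_eq_mul, Units.val_mul, mul_add, mul_smul_comm, hu, hv,
    smul_mul_assoc, add_mul, smul_mul_assoc, Units.mul_inv_cancel_left, smul_add, smul_comm q l]

/-- A closed subset of `ℂ` preserved and reflected by the rotation of irrational angle `2πθ` is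
mapped into itself by every rotation. -/
theorem IsClosed.mul_mem_of_irrational_rotation {S : Set ℂ} (hS : IsClosed S) {θ : ℝ}
    (hθ : Irrational θ)
    (h : ∀ z, Complex.exp (2 * Real.pi * Complex.I * θ) * z ∈ S ↔ z ∈ S)
    {ζ : ℂ} (hζ : ‖ζ‖ = 1) {z : ℂ} (hz : z ∈ S) : ζ * z ∈ S := by
  have hdense : Dense (AddSubgroup.closure {θ, 1} : Set ℝ) :=
    dense_addSubgroupClosure_pair_iff.2 (by simpa using hθ)
  have hmem : ∀ t ∈ AddSubgroup.closure {θ, (1 : ℝ)},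
      ∀ z, Complex.exp (2 * Real.pi * Complex.I * t) * z ∈ S ↔ z ∈ S := by
    intro t ht
    induction ht using AddSubgroup.closure_induction with
    | mem x hx =>
      rcases hx with rfl | rfl
      · exact h
      · simp [Complex.exp_two_pi_mul_I]
    | zero => simp
    | add x y _ _ hx hy =>
      intro z
      rw [Complex.ofReal_add, mul_add, Complex.exp_add, mul_assoc, hx, hy]
    | neg x _ hx =>
      intro z
      rw [← hx, ← mul_assoc, ← Complex.exp_add]
      simp
  have hclosed : IsClosed {t : ℝ | Complex.exp (2 * Real.pi * Complex.I * t) * z ∈ S} :=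
    hS.preimage (by fun_prop)
  have hall : ∀ t : ℝ, Complex.exp (2 * Real.pi * Complex.I * t) * z ∈ S := fun t =>
    closure_minimal (fun s hs => (hmem s hs z).2 hz) hclosed (hdense t)
  obtain ⟨t, rfl⟩ := (Complex.norm_eq_one_iff ζ).1 hζ
  convert hall (t / (2 * Real.pi)) using 3
  have : (Real.pi : ℂ) ≠ 0 := by exact_mod_cast Real.pi_ne_zero
  push_cast
  field_simp

/-- Let A be a unital C*-algebra, θ ∈ (0,1) irrational, u, v ∈ A unitaries
with vu = e^{2πiθ}uv.  Then for every λ > 0 the spectrum of u + λv is rotation invariant: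
ζ·σ(u + λv) = σ(u + λv) for every ζ ∈ ℂ with |ζ| = 1. -/
theorem stmt_13 {A : Type*} [NormedRing A] [StarRing A] [CStarRing A] [CompleteSpace A]
    [NormedAlgebra ℂ A] [StarModule ℂ A]
    (θ : ℝ) (hθ : θ ∈ Set.Ioo (0 : ℝ) 1) (hirr : Irrational θ)
    (u v : A) (hu : u ∈ unitary A) (hv : v ∈ unitary A)
    (hrel : v * u = Complex.exp (2 * Real.pi * Complex.I * θ) • (u * v))
    (lam : ℝ) (hlam : 0 < lam) (ζ : ℂ) (hζ : ‖ζ‖ = 1) :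
    (fun z : ℂ => ζ * z) '' spectrum ℂ (u + (lam : ℂ) • v)
      = spectrum ℂ (u + (lam : ℂ) • v) := by
  have h := spectrum.mul_mem_iff_of_conj_eq_smul _ (Units.mk0 _ (Complex.exp_ne_zero _))
    (Units.inv_mul_conj_add_smul (Unitary.toUnits ⟨u, hu⟩) (Unitary.toUnits ⟨v, hv⟩) _ (lam : ℂ)
      hrel)
  have hrot {η : ℂ} (hη : ‖η‖ = 1) {z : ℂ} (hz : z ∈ spectrum ℂ (u + (lam : ℂ) • v)) :
      η * z ∈ spectrum ℂ (u + (lam : ℂ) • v) :=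
    (spectrum.isClosed _).mul_mem_of_irrational_rotation hirr h hη hz
  have hζ0 : ζ ≠ 0 := norm_ne_zero_iff.1 (by simp [hζ])
  refine Set.Subset.antisymm (Set.image_subset_iff.2 fun z hz => hrot hζ hz) fun z hz => ?_
  exact ⟨ζ⁻¹ * z, hrot (by simp [hζ]) hz, mul_inv_cancel_left₀ hζ0 z⟩
end

section
/- Let A be a unital C*-algebra, θ ∈ (0,1) an irrational number, and u, v ∈ A unitary elements satisfying vu = e^{2πiθ}uv, such that the spectrum of u*v equals the full unit circle 𝕋. Then for every real λ with 0 < λ < 1, the spectrum of u + λv equals the unit circle 𝕋. -/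
open Complex in
/-- For `‖c‖ < 1`, the function `1 + c z` on the unit circle is, up to a factor of modulus close
to one, a multiplicative coboundary for any rotation `q` of infinite order. -/
lemma exists_approx_coboundary {q c : ℂ} (hq : ∀ n : ℕ, n ≠ 0 → q ^ n ≠ 1) (hc : ‖c‖ < 1)
    {δ : ℝ} (hδ : 0 < δ) :
    ∃ g : ℂ → ℂ, Continuous g ∧ ∀ z : ℂ, ‖z‖ = 1 →
      ‖(1 + c * z) * exp (g z - g (q * z))‖ ∈ Set.Icc (Real.exp (-δ)) (Real.exp δ) := by
  obtain ⟨n, hn⟩ : ∃ n : ℕ, ‖c‖ ^ (n + 1) * (1 - ‖c‖)⁻¹ < δ := by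
    have h := ((tendsto_pow_atTop_nhds_zero_of_lt_one (norm_nonneg c) hc).comp
      (Filter.tendsto_add_atTop_nat 1)).mul_const (1 - ‖c‖)⁻¹
    rw [zero_mul] at h
    exact (h.eventually_lt_const hδ).exists
  let g : ℂ → ℂ := fun z ↦
    ∑ j ∈ Finset.range (n + 1), (-1) ^ (j + 1) * (c * z) ^ j / j / (q ^ j - 1)
  refine ⟨g, by fun_prop, fun z hz ↦ ?_⟩
  have hg : g z - g (q * z) = -logTaylor (n + 1) (c * z) := by
    simp only [g, logTaylor, ← Finset.sum_sub_distrib, ← Finset.sum_neg_distrib]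
    refine Finset.sum_congr rfl fun j _ ↦ ?_
    rcases eq_or_ne j 0 with rfl | hj
    · simp
    · have h1 : q ^ j - 1 ≠ 0 := sub_ne_zero.mpr (hq j hj)
      have h2 : (j : ℂ) ≠ 0 := Nat.cast_ne_zero.mpr hj
      field_simp
      ring
  have hcz : ‖c * z‖ = ‖c‖ := by rw [norm_mul, hz, mul_one]
  have hne : 1 + c * z ≠ 0 :=
    slitPlane_ne_zero (mem_slitPlane_of_norm_lt_one (hcz ▸ hc))
  have hlog : ‖log (1 + c * z) - logTaylor (n + 1) (c * z)‖ ≤ δ := by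
    refine (norm_log_sub_logTaylor_le n (hcz ▸ hc)).trans ?_
    rw [hcz]
    refine (div_le_self ?_ (by linarith [n.cast_nonneg (α := ℝ)])).trans hn.le
    have : 0 < 1 - ‖c‖ := sub_pos.mpr hc
    positivity
  have hexp : (1 + c * z) * exp (g z - g (q * z)) =
      exp (log (1 + c * z) - logTaylor (n + 1) (c * z)) := by
    rw [hg, sub_eq_add_neg, exp_add, exp_log hne]
  rw [hexp, norm_exp]
  obtain ⟨h1, h2⟩ := abs_le.mp ((abs_re_le_norm _).trans hlog)
  exact ⟨Real.exp_le_exp.mpr h1, Real.exp_le_exp.mpr h2⟩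

/-- A nonempty closed subset of the unit circle that is invariant under an irrational rotation
is the whole circle. -/
lemma eq_sphere_of_irrational_rotation {θ : ℝ} (hθ : Irrational θ) {S : Set ℂ}
    (hS : S ⊆ Metric.sphere 0 1) (hne : S.Nonempty) (hcl : IsClosed S)
    (hrot : ∀ z, Complex.exp (2 * Real.pi * Complex.I * θ) * z ∈ S ↔ z ∈ S) :
    S = Metric.sphere 0 1 := by
  refine hS.antisymm fun y hy ↦ ?_
  obtain ⟨z, hz⟩ := hne
  have hz1 : ‖z‖ = 1 := by simpa using hS hz
  have hz0 : z ≠ 0 := by rintro rfl; simp at hz1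
  have hmul (k : ℤ) : Complex.exp (2 * Real.pi * Complex.I * θ) ^ k * z ∈ S := by
    induction k with
    | zero => simpa using hz
    | succ k ih =>
      rw [zpow_add_one₀ (Complex.exp_ne_zero _), mul_comm (_ ^ _), mul_assoc]
      exact (hrot _).mpr ih
    | pred k ih =>
      rw [← hrot, ← mul_assoc, ← zpow_one_add₀ (Complex.exp_ne_zero _)]
      convert ih using 3
      ring
  have hdense : DenseRange (· • (θ : AddCircle (1 : ℝ)) : ℤ → AddCircle (1 : ℝ)) :=
    AddCircle.denseRange_zsmul_coe_iff.mpr (by simpa using hθ)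
  have hE : IsClosed {x : AddCircle (1 : ℝ) | (AddCircle.toCircle x : ℂ) * z ∈ S} :=
    hcl.preimage (by fun_prop)
  have hall (x : AddCircle (1 : ℝ)) : (AddCircle.toCircle x : ℂ) * z ∈ S := by
    refine hdense.induction_on x hE fun k ↦ ?_
    convert hmul k using 2
    rw [AddCircle.toCircle_zsmul, Circle.coe_zpow, AddCircle.toCircle_apply_mk, Circle.coe_exp]
    congr 2
    push_cast
    ring
  have hyz : ‖y / z‖ = 1 := by rw [norm_div, hz1, div_one]; simpa using hy
  obtain ⟨x, hx⟩ := (AddCircle.homeomorphCircle (T := 1) one_ne_zero).surjective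
    ⟨y / z, mem_sphere_zero_iff_norm.mpr hyz⟩
  have hx' : (AddCircle.toCircle x : ℂ) = y / z := by
    rw [← AddCircle.homeomorphCircle_apply one_ne_zero, hx]
  simpa [hx', hz0] using hall x

section CStarAlgebra

variable {A : Type*} [CStarAlgebra A] {u w : A} {q : ℂ}

lemma cfc_mul_unitary (hu : u ∈ unitary A) (hw : w ∈ unitary A)
    (hrel : w * u = q • (u * w)) {f : ℂ → ℂ} (hf : Continuous f) :
    cfc f w * u = u * cfc (fun z ↦ f (q * z)) w := by
  have hn : IsStarNormal w := ⟨by rw [Commute, SemiconjBy, hw.1, hw.2]⟩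
  have hconj : star u * w * u = q • w := by
    rw [mul_assoc, hrel, mul_smul_comm, ← mul_assoc, hu.1, one_mul]
  have h := StarAlgHomClass.map_cfc (S := ℂ) (Unitary.conjStarAlgAut ℂ A (star ⟨u, hu⟩)) f w
    (by fun_prop) (by
      change Continuous fun x ↦ star u * x * star (star u)
      fun_prop) hn (by
      rw [Unitary.conjStarAlgAut_star_apply]
      simp only [hconj]
      infer_instance)
  simp only [Unitary.conjStarAlgAut_star_apply, hconj] at h
  rw [cfc_comp_const_mul q f w, ← h, mul_assoc, ← mul_assoc, hu.2, one_mul]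

lemma cfc_mul_cfc_eq {f g k : ℂ → ℂ} (hf : ContinuousOn f (spectrum ℂ w))
    (hg : ContinuousOn g (spectrum ℂ w)) (h : ∀ x ∈ spectrum ℂ w, f x * g x = k x) :
    cfc f w * cfc g w = cfc k w :=
  (cfc_mul f g w hf hg).symm.trans (cfc_congr h)

lemma norm_mem_Icc_of_mem_spectrum_unitary_mul [Nontrivial A] (hu : u ∈ unitary A)
    {r s : A} (hrs : r * s = 1) (hsr : s * r = 1) {δ : ℝ} (hr : ‖r‖ ≤ Real.exp δ)
    (hs : ‖s‖ ≤ Real.exp δ) {z : ℂ} (hz : z ∈ spectrum ℂ (u * r)) :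
    ‖z‖ ∈ Set.Icc (Real.exp (-δ)) (Real.exp δ) := by
  let y : Aˣ := ⟨u * r, s * star u,
    by rw [mul_assoc, ← mul_assoc r, hrs, one_mul, hu.2],
    by rw [mul_assoc, ← mul_assoc (star u), hu.1, one_mul, hsr]⟩
  have hy : z ∈ spectrum ℂ (y : A) := hz
  have hz0 : z ≠ 0 := by
    rintro rfl
    exact spectrum.zero_notMem ℂ y.isUnit hy
  have hupper : ‖z‖ ≤ Real.exp δ := by
    refine (spectrum.norm_le_norm_of_mem hz).trans ?_
    rwa [CStarRing.norm_mem_unitary_mul r hu]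
  have hlower : ‖z⁻¹‖ ≤ Real.exp δ := by
    refine (spectrum.norm_le_norm_of_mem (spectrum.inv₀_mem_inv_iff.mpr hy)).trans ?_
    change ‖s * star u‖ ≤ _
    rwa [CStarRing.norm_mul_mem_unitary s (Unitary.star_mem hu)]
  refine ⟨?_, hupper⟩
  rw [Real.exp_neg]
  rw [norm_inv] at hlower
  exact inv_le_of_inv_le₀ (norm_pos_iff.mpr hz0) hlower

lemma spectrum_unitary_mul_one_add_smul_subset [Nontrivial A] (hu : u ∈ unitary A)
    (hw : w ∈ unitary A) (hrel : w * u = q • (u * w)) (hq : ∀ n : ℕ, n ≠ 0 → q ^ n ≠ 1)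
    {c : ℂ} (hc : ‖c‖ < 1) :
    spectrum ℂ (u * (1 + c • w)) ⊆ Metric.sphere 0 1 := by
  intro z hz
  have hn : IsStarNormal w := ⟨by rw [Commute, SemiconjBy, hw.1, hw.2]⟩
  have hsp : ∀ x ∈ spectrum ℂ w, ‖x‖ = 1 := fun x hx ↦ by
    simpa using spectrum.subset_circle_of_unitary hw hx
  have key (δ : ℝ) (hδ : 0 < δ) : ‖z‖ ∈ Set.Icc (Real.exp (-δ)) (Real.exp δ) := by
    obtain ⟨g, hg, hgρ⟩ := exists_approx_coboundary hq hc hδ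
    let ρ : ℂ → ℂ := fun z ↦ (1 + c * z) * Complex.exp (g z - g (q * z))
    have hρ : Continuous ρ := by fun_prop
    have hρ0 : ∀ x ∈ spectrum ℂ w, ρ x ≠ 0 := fun x hx ↦
      norm_pos_iff.mp ((Real.exp_pos _).trans_le (hgρ x (hsp x hx)).1)
    have hρinv : ContinuousOn (fun x ↦ (ρ x)⁻¹) (spectrum ℂ w) := hρ.continuousOn.inv₀ hρ0
    have hrs : cfc ρ w * cfc (fun x ↦ (ρ x)⁻¹) w = 1 := by
      rw [← cfc_one ℂ w]
      exact cfc_mul_cfc_eq hρ.continuousOn hρinv fun x hx ↦ mul_inv_cancel₀ (hρ0 x hx)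
    have hsr : cfc (fun x ↦ (ρ x)⁻¹) w * cfc ρ w = 1 := by
      rw [← cfc_one ℂ w]
      exact cfc_mul_cfc_eq hρinv hρ.continuousOn fun x hx ↦ inv_mul_cancel₀ (hρ0 x hx)
    have hr : ‖cfc ρ w‖ ≤ Real.exp δ :=
      norm_cfc_le (Real.exp_pos _).le fun x hx ↦ (hgρ x (hsp x hx)).2
    have hs : ‖cfc (fun x ↦ (ρ x)⁻¹) w‖ ≤ Real.exp δ := by
      refine norm_cfc_le (Real.exp_pos _).le fun x hx ↦ ?_
      rw [norm_inv]
      refine inv_le_of_inv_le₀ (Real.exp_pos _) ?_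
      rw [← Real.exp_neg]
      exact (hgρ x (hsp x hx)).1
    let h : Aˣ := ⟨cfc (fun x ↦ Complex.exp (g x)) w, cfc (fun x ↦ Complex.exp (-g x)) w,
      by
        rw [← cfc_one ℂ w]
        exact cfc_mul_cfc_eq (by fun_prop) (by fun_prop) fun x _ ↦ by simp [← Complex.exp_add],
      by
        rw [← cfc_one ℂ w]
        exact cfc_mul_cfc_eq (by fun_prop) (by fun_prop) fun x _ ↦ by simp [← Complex.exp_add]⟩
    have hx : (1 + c • w) = cfc (fun x ↦ 1 + c * x) w := by
      rw [cfc_const_add 1 (fun x ↦ c * x) w, cfc_const_mul_id c w, map_one]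
    have hconj : u * (1 + c • w) * (h : A) = h * (u * cfc ρ w) := by
      change _ * cfc (fun x ↦ Complex.exp (g x)) w = cfc (fun x ↦ Complex.exp (g x)) w * _
      rw [← mul_assoc, cfc_mul_unitary hu hw hrel (f := fun x ↦ Complex.exp (g x)) (by fun_prop),
        hx, mul_assoc, mul_assoc]
      congr 1
      refine (cfc_mul_cfc_eq (by fun_prop) (by fun_prop) fun x _ ↦ ?_).trans
        (cfc_mul_cfc_eq (k := fun x ↦ (1 + c * x) * Complex.exp (g x))
          (by fun_prop) (by fun_prop) fun x _ ↦ ?_).symm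
      · rfl
      · simp only [ρ]
        rw [mul_left_comm, ← Complex.exp_add, add_sub_cancel]
    have hsim : spectrum ℂ (u * (1 + c • w)) = spectrum ℂ (u * cfc ρ w) := by
      rw [← spectrum.units_conjugate (a := u * cfc ρ w) (u := h), ← hconj, Units.mul_inv_cancel_right]
    exact norm_mem_Icc_of_mem_spectrum_unitary_mul hu hrs hsr hr hs (hsim ▸ hz)
  rw [mem_sphere_zero_iff_norm]
  have hz0 : 0 < ‖z‖ := (Real.exp_pos _).trans_le (key 1 one_pos).1
  have hlog : |Real.log ‖z‖| ≤ 0 := le_of_forall_pos_le_add fun δ hδ ↦ by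
    rw [zero_add, abs_le, Real.le_log_iff_exp_le hz0, Real.log_le_iff_le_exp hz0]
    exact key δ hδ
  rw [← Real.exp_log hz0, abs_nonpos_iff.mp hlog, Real.exp_zero]

lemma mul_mem_spectrum_unitary_mul_iff (hw : w ∈ unitary A) (hrel : w * u = q • (u * w))
    (hq : q ≠ 0) {r : A} (hr : Commute w r) (z : ℂ) :
    q * z ∈ spectrum ℂ (u * r) ↔ z ∈ spectrum ℂ (u * r) := by
  have hconj : w * (u * r) * star w = Units.mk0 q hq • (u * r) := by
    rw [← mul_assoc, hrel, smul_mul_assoc, mul_assoc u, hr.eq, smul_mul_assoc, mul_assoc u,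
      mul_assoc r, hw.2, mul_one]
    rfl
  have h := Unitary.spectrum_star_right_conjugate (R := ℂ) (a := u * r) (U := ⟨w, hw⟩)
  change spectrum ℂ (w * (u * r) * star w) = _ at h
  rw [hconj, spectrum.unit_smul_eq_smul] at h
  conv_lhs => rw [← h]
  exact Set.smul_mem_smul_set_iff (a := Units.mk0 q hq)

lemma spectrum_add_smul_eq_sphere [Nontrivial A] {θ : ℝ} (hθ : Irrational θ) {v : A}
    (hu : u ∈ unitary A) (hv : v ∈ unitary A)
    (hrel : v * u = Complex.exp (2 * Real.pi * Complex.I * θ) • (u * v))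
    {c : ℂ} (hc : ‖c‖ < 1) :
    spectrum ℂ (u + c • v) = Metric.sphere 0 1 := by
  have hw : star u * v ∈ unitary A := mul_mem (Unitary.star_mem hu) hv
  have huw : u * (star u * v) = v := by rw [← mul_assoc, hu.2, one_mul]
  have hrel' : star u * v * u =
      Complex.exp (2 * Real.pi * Complex.I * θ) • (u * (star u * v)) := by
    rw [mul_assoc, hrel, mul_smul_comm, huw, ← mul_assoc, hu.1, one_mul]
  have hx : u + c • v = u * (1 + c • (star u * v)) := by
    rw [mul_add, mul_one, mul_smul_comm, huw]
  have hq (n : ℕ) (hn : n ≠ 0) : Complex.exp (2 * Real.pi * Complex.I * θ) ^ n ≠ 1 := by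
    rw [← Complex.exp_nat_mul, Ne, Complex.exp_eq_one_iff]
    rintro ⟨k, hk⟩
    refine (hθ.natCast_mul hn).ne_int k ?_
    have h2 : (2 * Real.pi * Complex.I) * ((n : ℂ) * θ) = (2 * Real.pi * Complex.I) * k := by
      linear_combination hk
    exact_mod_cast mul_left_cancel₀ Complex.two_pi_I_ne_zero h2
  rw [hx]
  exact eq_sphere_of_irrational_rotation hθ
    (spectrum_unitary_mul_one_add_smul_subset hu hw hrel' hq hc)
    (spectrum.nonempty _) (spectrum.isClosed _)
    (mul_mem_spectrum_unitary_mul_iff hw hrel' (Complex.exp_ne_zero _)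
      ((Commute.one_right _).add_right ((Commute.refl _).smul_right c)))

end CStarAlgebra


/-- Let A be a unital C*-algebra, θ ∈ (0,1) irrational, u, v ∈ A unitaries
with vu = e^{2πiθ}uv and σ(u*v) = 𝕋.  Then for every 0 < λ < 1, the spectrum of
u + λv equals the unit circle 𝕋. -/
theorem stmt_14 {A : Type*} [NormedRing A] [StarRing A] [CStarRing A] [CompleteSpace A]
    [NormedAlgebra ℂ A] [StarModule ℂ A]
    (θ : ℝ) (hθ : θ ∈ Set.Ioo (0 : ℝ) 1) (hirr : Irrational θ)
    (u v : A) (hu : u ∈ unitary A) (hv : v ∈ unitary A)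
    (hrel : v * u = Complex.exp (2 * Real.pi * Complex.I * θ) • (u * v))
    (hspec : spectrum ℂ (star u * v) = Metric.sphere (0 : ℂ) 1)
    (lam : ℝ) (h0 : 0 < lam) (h1 : lam < 1) :
    spectrum ℂ (u + (lam : ℂ) • v) = Metric.sphere (0 : ℂ) 1 := by
  let : CStarAlgebra A := { }
  have : Nontrivial A := by
    by_contra h
    rw [not_nontrivial_iff_subsingleton] at h
    rw [spectrum.of_subsingleton] at hspec
    exact (NormedSpace.sphere_nonempty (x := (0 : ℂ)).mpr zero_le_one).ne_empty hspec.symm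
  exact spectrum_add_smul_eq_sphere hirr hu hv hrel (by simpa [abs_of_pos h0] using h1)
end

section
/- Let θ ∈ (0,1) be an irrational number and let α : ℤ × ℤ → ℂ be a family of complex numbers with Σ_{m,n ∈ ℤ} |α(m,n)|² < ∞ satisfying the recurrence α(m−1, n)(1 − e^{2πinθ}) = α(m, n−1)(1 − e^{2πimθ}) for all m, n ∈ ℤ. Then α(m,n) = 0 whenever m < 0 or n < 0. -/
open Filter Topology in
/-- Powers of a point of the circle return arbitrarily close to `1`, so a continuous function
whose values along the powers tend to `0` vanishes at `1`. -/
theorem Circle.eq_zero_at_one_of_tendsto_pow (w : Circle) {f : Circle → ℝ} (hf : Continuous f)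
    (h : Tendsto (fun m : ℕ => f (w ^ m)) atTop (𝓝 0)) : f 1 = 0 := by
  have hc : MapClusterPt (1 : Circle) atTop (fun m : ℕ => w ^ m) := mapClusterPt_one_atTop_pow w
  have hc' : MapClusterPt (f 1) atTop (fun m : ℕ => f (w ^ m)) :=
    hc.tendsto_comp hf.continuousAt
  have : (𝓝 (f 1) ⊓ 𝓝 0).NeBot := ClusterPt.mono hc' h
  exact eq_of_nhds_neBot this

theorem Circle.norm_one_sub_zpow_neg (w : Circle) (k : ℤ) :
    ‖1 - (w : ℂ) ^ (-k)‖ = ‖1 - (w : ℂ) ^ k‖ := by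
  have hw : (w : ℂ) ^ k ≠ 0 := zpow_ne_zero _ w.coe_ne_zero
  have h : 1 - (w : ℂ) ^ (-k) = -((w : ℂ) ^ k)⁻¹ * (1 - (w : ℂ) ^ k) := by
    rw [zpow_neg]; field_simp; ring
  rw [h, norm_mul, norm_neg, norm_inv, norm_zpow, Circle.norm_coe]
  simp

section Recurrence

variable {w : Circle} {α : ℤ × ℤ → ℂ}

open Filter Topology in
/-- Along the ray `(m, -1 - t - m)`, the norm of `α` is proportional to
`∏ i < t, ‖1 - w ^ (m + i + 1)‖`, which does not tend to `0`. -/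
theorem eq_zero_of_recurrence_of_fst_eq_zero (hw : ∀ k : ℤ, k ≠ 0 → 1 - (w : ℂ) ^ k ≠ 0)
    (hsum : Summable fun p : ℤ × ℤ => ‖α p‖ ^ 2)
    (hrec : ∀ m n : ℤ, α (m - 1, n) * (1 - (w : ℂ) ^ n) = α (m, n - 1) * (1 - (w : ℂ) ^ m))
    (t : ℕ) : α (0, -1 - t) = 0 := by
  set a : ℕ → ℂ := fun m => α (m, -1 - t - m) with ha
  set f : Circle → ℝ := fun z => ∏ i ∈ Finset.range t, ‖1 - (z : ℂ) * (w : ℂ) ^ (i + 1)‖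
  have hw' (k : ℕ) : ‖1 - (w : ℂ) ^ (k + 1)‖ ≠ 0 := by
    simpa only [norm_ne_zero_iff] using mod_cast hw ((k + 1 : ℕ) : ℤ) (by omega)
  have hstep (m : ℕ) :
      ‖a (m + 1)‖ * ‖1 - (w : ℂ) ^ (m + 1)‖ = ‖a m‖ * ‖1 - (w : ℂ) ^ (m + t + 1)‖ := by
    have h := congrArg norm (hrec ((m + 1 : ℕ) : ℤ) (-((m + t + 1 : ℕ) : ℤ)))
    rw [norm_mul, norm_mul, Circle.norm_one_sub_zpow_neg, zpow_natCast, zpow_natCast] at h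
    rw [show (((m + 1 : ℕ) : ℤ) - 1, -((m + t + 1 : ℕ) : ℤ)) = ((m : ℤ), -1 - (t : ℤ) - m) by
        ext <;> push_cast <;> ring,
      show (((m + 1 : ℕ) : ℤ), -((m + t + 1 : ℕ) : ℤ) - 1)
        = (((m + 1 : ℕ) : ℤ), -1 - (t : ℤ) - ((m + 1 : ℕ) : ℤ)) by
        ext <;> push_cast <;> ring] at h
    exact h.symm
  have hfstep (m : ℕ) : f (w ^ (m + 1)) * ‖1 - (w : ℂ) ^ (m + 1)‖
      = f (w ^ m) * ‖1 - (w : ℂ) ^ (m + t + 1)‖ := by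
    have h := (Finset.prod_range_succ' (fun i => ‖1 - (w : ℂ) ^ (m + i + 1)‖) t).symm.trans
      (Finset.prod_range_succ (fun i => ‖1 - (w : ℂ) ^ (m + i + 1)‖) t)
    convert h using 3
    · simp only [Circle.coe_pow, ← pow_add]
      congr 3
      ring
    · simp only [Circle.coe_pow, ← pow_add, add_assoc]
  have hclosed (m : ℕ) : ‖a m‖ * f 1 = ‖a 0‖ * f (w ^ m) := by
    induction m with
    | zero => simp
    | succ m ih =>
      apply mul_right_cancel₀ (hw' m)
      linear_combination f 1 * hstep m - ‖a 0‖ * hfstep m + ‖1 - (w : ℂ) ^ (m + t + 1)‖ * ih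
  have hinj : Function.Injective fun m : ℕ => ((m : ℤ), -1 - (t : ℤ) - m) := fun x y h => by
    simpa using congrArg Prod.fst h
  have hlim : Tendsto (fun m => ‖a m‖) atTop (𝓝 0) := by
    have h := (hsum.comp_injective hinj).tendsto_atTop_zero.sqrt
    simpa [Function.comp_def, Real.sqrt_sq] using h
  have hf1 : f 1 ≠ 0 := by
    refine Finset.prod_ne_zero_iff.2 fun i _ => ?_
    simpa using hw' i
  have hcont : Continuous fun z => ‖a 0‖ * f z := by fun_prop
  have h0 : ‖a 0‖ * f 1 = 0 := w.eq_zero_at_one_of_tendsto_pow hcont <| by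
    simpa [← hclosed] using hlim.mul_const (f 1)
  simpa [ha] using (mul_eq_zero.1 h0).resolve_right hf1

theorem eq_zero_of_recurrence_of_snd_neg (hw : ∀ k : ℤ, k ≠ 0 → 1 - (w : ℂ) ^ k ≠ 0)
    (hsum : Summable fun p : ℤ × ℤ => ‖α p‖ ^ 2)
    (hrec : ∀ m n : ℤ, α (m - 1, n) * (1 - (w : ℂ) ^ n) = α (m, n - 1) * (1 - (w : ℂ) ^ m))
    (m : ℤ) : ∀ n < 0, α (m, n) = 0 := by
  induction m with
  | zero =>
    intro n hn
    have h := eq_zero_of_recurrence_of_fst_eq_zero hw hsum hrec (-1 - n).toNat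
    rwa [Int.toNat_of_nonneg (by omega), sub_sub_cancel] at h
  | succ m ih =>
    intro n hn
    have h := hrec (m + 1) (n + 1)
    rw [add_sub_cancel_right, add_sub_cancel_right] at h
    refine (mul_eq_zero.1 (h.symm.trans ?_)).resolve_right (hw _ (by omega))
    rcases (show n + 1 < 0 ∨ n + 1 = 0 by omega) with h' | h'
    · rw [ih _ h', zero_mul]
    · simp [h']
  | pred m ih =>
    intro n hn
    have h := hrec (-m) n
    rw [ih (n - 1) (by omega), zero_mul] at h
    exact (mul_eq_zero.1 h).resolve_right (hw _ hn.ne)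

end Recurrence

/-- Let θ ∈ (0,1) be irrational and α : ℤ × ℤ → ℂ square-summable with
α(m−1,n)(1 − e^{2πinθ}) = α(m,n−1)(1 − e^{2πimθ}) for all m, n ∈ ℤ.
Then α(m,n) = 0 whenever m < 0 or n < 0. -/
theorem stmt_16 (θ : ℝ) (hθ : θ ∈ Set.Ioo (0 : ℝ) 1) (hirr : Irrational θ)
    (α : ℤ × ℤ → ℂ) (hsum : Summable fun p : ℤ × ℤ => ‖α p‖ ^ 2)
    (hrec : ∀ m n : ℤ,
      α (m - 1, n) * (1 - Complex.exp (2 * Real.pi * Complex.I * θ * n))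
        = α (m, n - 1) * (1 - Complex.exp (2 * Real.pi * Complex.I * θ * m))) :
    ∀ m n : ℤ, (m < 0 ∨ n < 0) → α (m, n) = 0 := by
  set w : Circle := Circle.exp (2 * Real.pi * θ) with hwdef
  have hexp (k : ℤ) : Complex.exp (2 * Real.pi * Complex.I * θ * k) = (w : ℂ) ^ k := by
    rw [hwdef, Circle.coe_exp, ← Complex.exp_int_mul]
    push_cast
    ring_nf
  have hw (k : ℤ) (hk : k ≠ 0) : 1 - (w : ℂ) ^ k ≠ 0 := by
    rw [← hexp, sub_ne_zero, ne_comm, Ne, Complex.exp_eq_one_iff]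
    rintro ⟨n, hn⟩
    have h : ((θ * k : ℝ) : ℂ) = ((n : ℝ) : ℂ) := by
      apply mul_right_cancel₀ Complex.two_pi_I_ne_zero
      push_cast
      linear_combination hn
    exact (hirr.mul_intCast hk).ne_int n (Complex.ofReal_injective h)
  simp only [hexp] at hrec
  rintro m n (h | h)
  · exact eq_zero_of_recurrence_of_snd_neg (α := α ∘ Prod.swap) hw
      (hsum.comp_injective Prod.swap_injective) (fun m n => (hrec n m).symm) n m h
  · exact eq_zero_of_recurrence_of_snd_neg hw hsum hrec m n h
end

section
/- Let k ≥ 2 and r ≥ 1 be integers with r not divisible by k, and for each positive integer s define f_{s,r,k}(z) = ∏_{t=1}^{s} (1 − z^{kt+r})/(1 − z^{kt}) for z in the unit circle 𝕋 with z^{kt} ≠ 1 for all 1 ≤ t ≤ s. Then the set E_{r,k} = {z ∈ 𝕋 : z^{kt} ≠ 1 for all positive integers t, and lim_{s→∞} f_{s,r,k}(z) = 0} is a meagre (first category) subset of 𝕋. -/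
open Complex in
/-- The parametrisation `x ↦ exp (2πix)` of the unit circle. -/
noncomputable def circleParam (x : ℝ) : Metric.sphere (0 : ℂ) 1 :=
  ⟨exp ((2 * Real.pi * x : ℝ) * I), mem_sphere_zero_iff_norm.2 (norm_exp_ofReal_mul_I _)⟩

theorem continuous_circleParam : Continuous circleParam := by
  unfold circleParam
  fun_prop

theorem surjective_circleParam : Function.Surjective circleParam := by
  rintro ⟨z, hz⟩
  refine ⟨z.arg / (2 * Real.pi), Subtype.ext ?_⟩
  have hz' : ‖z‖ = 1 := by simpa using hz
  have h := Complex.norm_mul_exp_arg_mul_I z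
  rw [hz', Complex.ofReal_one, one_mul] at h
  simpa only [circleParam, mul_div_cancel₀ _ Real.two_pi_pos.ne'] using h

theorem circleParam_pow_eq_one_iff (x : ℝ) (n : ℕ) :
    (circleParam x : ℂ) ^ n = 1 ↔ ∃ m : ℤ, n * x = m := by
  rw [circleParam, ← Complex.exp_nat_mul, Complex.exp_eq_one_iff]
  refine exists_congr fun m => ?_
  push_cast
  rw [show (n : ℂ) * (2 * Real.pi * x * Complex.I) = n * x * (2 * Real.pi * Complex.I) by ring,
    mul_left_inj' Complex.two_pi_I_ne_zero]
  norm_cast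

/-- Fractions with denominator a power of `k` and numerator congruent to `1` modulo `k` are dense. -/
theorem dense_int_mul_add_one_div_pow {k : ℕ} (hk : 2 ≤ k) :
    Dense {x : ℝ | ∃ (j : ℤ) (n : ℕ), x = (k * j + 1) / k ^ (n + 1)} := by
  refine dense_of_exists_between fun a b hab => ?_
  have hk' : (2 : ℝ) ≤ k := by exact_mod_cast hk
  have hk0 : (0 : ℝ) < k := by linarith
  obtain ⟨n, hn⟩ := exists_pow_lt_of_lt_one (half_pos (sub_pos.2 hab))
    (inv_lt_one_of_one_lt₀ (by linarith : (1 : ℝ) < k))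
  refine ⟨_, ⟨⌊a * k ^ n⌋ + 1, n, rfl⟩, ?_, ?_⟩
  · rw [lt_div_iff₀ (by positivity)]
    have := Int.lt_floor_add_one (a * (k : ℝ) ^ n)
    push_cast
    rw [pow_succ]
    nlinarith
  · rw [div_lt_iff₀ (by positivity)]
    have h := Int.floor_le (a * (k : ℝ) ^ n)
    have h2 : 1 < (b - a) / 2 * (k : ℝ) ^ n := by
      rwa [inv_pow, inv_lt_iff_one_lt_mul₀ (by positivity)] at hn
    push_cast
    rw [pow_succ]
    nlinarith

theorem circleParam_pow_ne_one {k m : ℕ} (hk : k ≠ 0) (hm : ¬ k ∣ m) (j : ℤ) (n : ℕ) :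
    (circleParam ((k * j + 1) / k ^ (n + 1)) : ℂ) ^ m ≠ 1 := by
  rw [Ne, circleParam_pow_eq_one_iff]
  rintro ⟨l, hl⟩
  rw [← mul_div_assoc, div_eq_iff (by positivity)] at hl
  have h : (m : ℤ) * (k * j + 1) = l * k ^ (n + 1) := by exact_mod_cast hl
  refine hm (Int.natCast_dvd_natCast.1 ⟨l * k ^ n - m * j, ?_⟩)
  linear_combination h

theorem circleParam_pow_eq_one {k : ℕ} (hk : k ≠ 0) (j : ℤ) (n : ℕ) :
    (circleParam ((k * j + 1) / k ^ (n + 1)) : ℂ) ^ (k * k ^ n) = 1 := by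
  rw [circleParam_pow_eq_one_iff]
  refine ⟨k * j + 1, ?_⟩
  push_cast
  field_simp
  ring

/-- Let k ≥ 2 and r ≥ 1 be integers with k ∤ r, and for s ≥ 1 set
f_{s,r,k}(z) = ∏_{t=1}^{s} (1 − z^{kt+r})/(1 − z^{kt}).  Then the set
E_{r,k} = {z ∈ 𝕋 : z^{kt} ≠ 1 for all t ≥ 1, and f_{s,r,k}(z) → 0 as s → ∞}
is a meagre (first category) subset of the unit circle 𝕋. -/
theorem stmt_17 (k r : ℕ) (hk : 2 ≤ k) (hr : 1 ≤ r) (hkr : ¬ k ∣ r) :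
    IsMeagre {z : Metric.sphere (0 : ℂ) 1 |
      (∀ t : ℕ, 1 ≤ t → (z : ℂ) ^ (k * t) ≠ 1) ∧
      Filter.Tendsto (fun s : ℕ => ∏ t ∈ Finset.Icc 1 s,
          (1 - (z : ℂ) ^ (k * t + r)) / (1 - (z : ℂ) ^ (k * t)))
        Filter.atTop (nhds 0)} := by
  let U : ℕ → Set (Metric.sphere (0 : ℂ) 1) := fun N =>
    ⋃ s ≥ N, {z | ‖∏ t ∈ Finset.Icc 1 s, (1 - (z : ℂ) ^ (k * t))‖ <
      ‖∏ t ∈ Finset.Icc 1 s, (1 - (z : ℂ) ^ (k * t + r))‖}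
  have hopen (N : ℕ) : IsOpen (U N) :=
    isOpen_biUnion fun s _ => isOpen_lt (by fun_prop) (by fun_prop)
  have hdense (N : ℕ) : Dense (U N) := by
    refine (surjective_circleParam.denseRange.dense_image continuous_circleParam
      (dense_int_mul_add_one_div_pow hk)).mono ?_
    rintro _ ⟨_, ⟨j, n, rfl⟩, rfl⟩
    refine Set.mem_biUnion (le_max_left N (k ^ n)) ?_
    have hzero := Finset.prod_eq_zero
      (f := fun t => 1 - (circleParam ((k * j + 1) / k ^ (n + 1)) : ℂ) ^ (k * t))
      (Finset.mem_Icc.2 ⟨Nat.one_le_pow n k (by omega), le_max_right N (k ^ n)⟩)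
      (sub_eq_zero.2 (circleParam_pow_eq_one (by omega) j n).symm)
    rw [Set.mem_ofPred_eq, hzero, norm_zero, norm_pos_iff, Finset.prod_ne_zero_iff]
    intro t _
    refine sub_ne_zero.2 (circleParam_pow_ne_one (by omega) ?_ j n).symm
    rwa [Nat.dvd_add_right (dvd_mul_right k t)]
  refine Filter.mem_of_superset
    (countable_iInter_mem.2 fun N => residual_of_dense_open (hopen N) (hdense N)) ?_
  rintro z hz ⟨hne, hlim⟩
  obtain ⟨N, hN⟩ := Filter.eventually_atTop.1
    (hlim.norm.eventually_lt_const (by simp : ‖(0 : ℂ)‖ < 1))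
  obtain ⟨s, hs, hlt⟩ := Set.mem_iUnion₂.1 (Set.mem_iInter.1 hz N)
  have hpos : 0 < ‖∏ t ∈ Finset.Icc 1 s, (1 - (z : ℂ) ^ (k * t))‖ := by
    rw [norm_pos_iff, Finset.prod_ne_zero_iff]
    exact fun t ht => sub_ne_zero.2 (hne t (Finset.mem_Icc.1 ht).1).symm
  have h := hN s hs
  rw [Finset.prod_div_distrib, norm_div, div_lt_one hpos] at h
  exact lt_asymm h hlt
end

section
/- Let A be a unital C*-algebra, θ ∈ (0,1) an irrational number, and u, w ∈ A unitary elements satisfying uw = e^{-2πiθ}wu. Then for every nonzero integer k and every element c ∈ A commuting with w, the Cesàro averages (1/(2n+1)) Σ_{j=−n}^{n} w^j (u^k c) (w*)^j converge to 0 in norm as n → ∞, where u^k denotes (u*)^{−k} when k < 0. -/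
open Filter

section ScalarCommutation

variable {K A G : Type*} [Field K] [Ring A] [Algebra K A] [Group G]

theorem mul_swap_of_mul_eq_smul_mul {x y : A} {μ : K} (hμ : μ ≠ 0) (h : x * y = μ • (y * x)) :
    y * x = μ⁻¹ • (x * y) := by
  rw [h, inv_smul_smul₀ hμ]

theorem MonoidHom.mul_map_zpow_of_mul_eq_smul_mul (f : G →* A) {x : A} {b : G} {μ : K}
    (hμ : μ ≠ 0) (h : x * f b = μ • (f b * x)) (k : ℤ) :
    x * f (b ^ k) = μ ^ k • (f (b ^ k) * x) := by
  have hinv : x * f b⁻¹ = μ⁻¹ • (f b⁻¹ * x) := by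
    have h₁ : f b⁻¹ * f b = 1 := by rw [← map_mul, inv_mul_cancel, map_one]
    have h₂ : f b * f b⁻¹ = 1 := by rw [← map_mul, mul_inv_cancel, map_one]
    calc x * f b⁻¹ = f b⁻¹ * (f b * x) * f b⁻¹ := by rw [← mul_assoc, h₁, one_mul]
      _ = μ⁻¹ • (f b⁻¹ * (x * (f b * f b⁻¹))) := by
        rw [mul_swap_of_mul_eq_smul_mul hμ h]
        simp only [mul_smul_comm, smul_mul_assoc, mul_assoc]
      _ = μ⁻¹ • (f b⁻¹ * x) := by rw [h₂, mul_one]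
  induction k using Int.induction_on with
  | zero => simp
  | succ n ih =>
    rw [zpow_add_one, map_mul, ← mul_assoc, ih, smul_mul_assoc, mul_assoc, h, mul_smul_comm,
      smul_smul, ← zpow_add_one₀ hμ, mul_assoc]
  | pred n ih =>
    rw [zpow_sub_one, map_mul, ← mul_assoc, ih, smul_mul_assoc, mul_assoc, hinv, mul_smul_comm,
      smul_smul, ← zpow_sub_one₀ hμ, mul_assoc]

theorem MonoidHom.map_zpow_mul_map_zpow_of_mul_eq_smul_mul (f : G →* A) {a b : G} {μ : K}
    (hμ : μ ≠ 0) (h : f a * f b = μ • (f b * f a)) (j k : ℤ) :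
    f (b ^ j) * f (a ^ k) = (μ ^ (-k)) ^ j • (f (a ^ k) * f (b ^ j)) := by
  have h₁ := mul_swap_of_mul_eq_smul_mul (zpow_ne_zero j hμ)
    (f.mul_map_zpow_of_mul_eq_smul_mul hμ h j)
  rw [f.mul_map_zpow_of_mul_eq_smul_mul (inv_ne_zero (zpow_ne_zero j hμ)) h₁ k,
    ← zpow_neg, ← zpow_mul, ← zpow_mul]
  congr 2
  ring

end ScalarCommutation

theorem sub_one_mul_sum_Icc_neg_zpow {K : Type*} [Field K] {ν : K} (hν : ν ≠ 0) (n : ℕ) :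
    (ν - 1) * ∑ j ∈ Finset.Icc (-(n : ℤ)) n, ν ^ j = ν ^ ((n : ℤ) + 1) - ν ^ (-(n : ℤ)) := by
  induction n with
  | zero => simp
  | succ n ih =>
    push_cast
    rw [Finset.sum_Icc_succ_eq_add_endpoints, mul_add, ih]
    have h₁ : ν ^ ((n : ℤ) + 1 + 1) = ν ^ ((n : ℤ) + 1) * ν := zpow_add_one₀ hν _
    have h₂ : ν ^ (-(n : ℤ)) = ν ^ (-((n : ℤ) + 1)) * ν := by
      rw [← zpow_add_one₀ hν]
      congr 1
      ring
    rw [h₁, h₂]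
    ring

theorem tendsto_cesaro_zpow_of_norm_eq_one {ν : ℂ} (hν : ‖ν‖ = 1) (hν1 : ν ≠ 1) :
    Tendsto (fun n : ℕ => (2 * (n : ℂ) + 1)⁻¹ * ∑ j ∈ Finset.Icc (-(n : ℤ)) n, ν ^ j)
      atTop (nhds 0) := by
  have hν0 : ν ≠ 0 := by
    rintro rfl
    simp at hν
  have hpos : 0 < ‖ν - 1‖ := norm_pos_iff.mpr (sub_ne_zero.mpr hν1)
  have hbound (n : ℕ) : ‖∑ j ∈ Finset.Icc (-(n : ℤ)) n, ν ^ j‖ ≤ 2 / ‖ν - 1‖ := by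
    rw [le_div_iff₀' hpos, ← norm_mul, sub_one_mul_sum_Icc_neg_zpow hν0]
    refine (norm_sub_le _ _).trans ?_
    simp only [norm_zpow, hν, one_zpow]
    norm_num
  have hinv : Tendsto (fun n : ℕ => (2 * (n : ℂ) + 1)⁻¹) atTop (nhds 0) := by
    refine squeeze_zero_norm (fun n => ?_) (tendsto_one_div_add_atTop_nhds_zero_nat (𝕜 := ℝ))
    have : ‖2 * (n : ℂ) + 1‖ = 2 * (n : ℝ) + 1 := by
      exact_mod_cast Complex.norm_natCast (2 * n + 1)
    rw [norm_inv, this, ← one_div]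
    gcongr
    linarith [n.cast_nonneg (α := ℝ)]
  exact hinv.zero_mul_isBoundedUnder_le (isBoundedUnder_of ⟨_, hbound⟩)

theorem Irrational.exp_neg_two_pi_mul_I_zpow_ne_one {θ : ℝ} (hθ : Irrational θ) {k : ℤ}
    (hk : k ≠ 0) : Complex.exp (-(2 * Real.pi * Complex.I * θ)) ^ k ≠ 1 := by
  rw [← Complex.exp_int_mul, Ne, Complex.exp_eq_one_iff]
  rintro ⟨n, hn⟩
  have h : (k : ℂ) * θ = ((-n : ℤ) : ℂ) := by
    apply mul_right_cancel₀ Complex.two_pi_I_ne_zero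
    push_cast
    linear_combination -hn
  exact (hθ.intCast_mul hk).ne_int (-n) (by exact_mod_cast h)

/-- Let A be a unital C*-algebra, θ ∈ (0,1) irrational, and u, w ∈ A
unitaries with uw = e^{-2πiθ}wu.  Then for every nonzero integer k and every c ∈ A
commuting with w, the Cesàro averages (1/(2n+1)) Σ_{j=−n}^{n} wʲ (uᵏ c)(w*)ʲ converge
to 0 in norm (uᵏ meaning (u*)^{−k} for k < 0). -/
theorem stmt_18 {A : Type*} [NormedRing A] [StarRing A] [CStarRing A] [CompleteSpace A]
    [NormedAlgebra ℂ A] [StarModule ℂ A]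
    (θ : ℝ) (hθ : θ ∈ Set.Ioo (0 : ℝ) 1) (hirr : Irrational θ)
    (u w : unitary A)
    (hrel : (u : A) * w = Complex.exp (-(2 * Real.pi * Complex.I * θ)) • ((w : A) * u))
    (k : ℤ) (hk : k ≠ 0) (c : A) (hc : c * (w : A) = (w : A) * c) :
    Tendsto (fun n : ℕ => ((2 * (n : ℂ) + 1)⁻¹ : ℂ) •
        ∑ j ∈ Finset.Icc (-(n : ℤ)) (n : ℤ),
          (↑(w ^ j) : A) * ((↑(u ^ k) : A) * c) * (↑((star w : unitary A) ^ j) : A))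
      atTop (nhds 0) := by
  set ζ := Complex.exp (-(2 * Real.pi * Complex.I * θ)) with hζ
  have hζ0 : ζ ≠ 0 := Complex.exp_ne_zero _
  have hζnorm : ‖ζ‖ = 1 := by
    rw [hζ, Complex.norm_exp]
    simp
  have hterm (j : ℤ) : (↑(w ^ j) : A) * ((↑(u ^ k) : A) * c) * (↑((star w : unitary A) ^ j) : A)
      = (ζ ^ (-k)) ^ j • ((↑(u ^ k) : A) * c) := by
    have hcomm : (↑(w ^ j) : A) * (↑(u ^ k) : A)
        = (ζ ^ (-k)) ^ j • ((↑(u ^ k) : A) * (↑(w ^ j) : A)) :=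
      (unitary A).subtype.map_zpow_mul_map_zpow_of_mul_eq_smul_mul hζ0 hrel j k
    have hcw : c * (↑(w ^ j) : A) = (↑(w ^ j) : A) * c := by
      simpa using (unitary A).subtype.mul_map_zpow_of_mul_eq_smul_mul (K := ℂ) one_ne_zero
        (by simpa using hc) j
    have hcancel : (↑(w ^ j) : A) * (↑((star w : unitary A) ^ j) : A) = 1 := by
      rw [Unitary.star_eq_inv, inv_zpow, ← Submonoid.coe_mul, mul_inv_cancel, Submonoid.coe_one]
    rw [← mul_assoc, hcomm, smul_mul_assoc, smul_mul_assoc, mul_assoc _ _ c, ← hcw, ← mul_assoc,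
      mul_assoc, hcancel, mul_one]
  simp only [hterm, ← Finset.sum_smul, smul_smul]
  have hν : ‖ζ ^ (-k)‖ = 1 := by rw [norm_zpow, hζnorm, one_zpow]
  have hlim := tendsto_cesaro_zpow_of_norm_eq_one hν
    (hirr.exp_neg_two_pi_mul_I_zpow_ne_one (neg_ne_zero.mpr hk))
  simpa using hlim.smul_const ((↑(u ^ k) : A) * c)
end
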